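/- arXiv:2102.06193 — 4 statements merged into one kernel-verified Lean document; each statement's English description precedes it below -/
import Mathlib

section
/- Let μ : ℕ → ℝ be a real sequence. The following two conditions are equivalent: (i) there exists a positive Borel measure ν on ℝ, supported in [0, ∞), such that for every k ∈ ℕ the Laguerre function 𝓛_k is ν-integrable and μ_k = ∫ 𝓛_k dν; (ii) for every m ∈ ℕ and every choice of real coefficients g_0, …, g_m such that the function x ↦ ∑_{k=0}^{m} g_k 𝓛_k(x) is nonnegative at every x ≥ 0, one has ∑_{k=0}^{m} μ_k g_k ≥ 0. -/
open MeasureTheory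

/-- The `k`-th Laguerre polynomial: `L_k(x) = ∑_{l=0}^k ((-1)^l / l!) C(k,l) x^l`. -/
noncomputable def laguerreL (k : ℕ) (x : ℝ) : ℝ :=
  ∑ l ∈ Finset.range (k + 1), ((-1 : ℝ) ^ l / (l.factorial : ℝ)) * (k.choose l : ℝ) * x ^ l

/-- The `k`-th Laguerre function: `𝓛_k(x) = (-1)^k L_k(x) e^{-x/2}`. -/
noncomputable def laguerreFun (k : ℕ) (x : ℝ) : ℝ :=
  (-1 : ℝ) ^ k * laguerreL k x * Real.exp (-x / 2)

open Polynomial Filter Topology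
open scoped NNReal CompactlySupported

/-- A functional on polynomials that is nonnegative on the polynomials nonnegative on `[0, ∞)`
induces a positive functional on `C_c([0, ∞), ℝ)` that it dominates. -/
lemma exists_positiveLinearMap_le (φ : ℝ[X] →ₗ[ℝ] ℝ)
    (hφ : ∀ p : ℝ[X], (∀ x : ℝ≥0, 0 ≤ p.eval (x : ℝ)) → 0 ≤ φ p) :
    ∃ Λ : C_c(ℝ≥0, ℝ) →ₚ[ℝ] ℝ, ∀ (p : ℝ[X]) (f : C_c(ℝ≥0, ℝ)),
      (∀ x : ℝ≥0, f x ≤ p.eval (x : ℝ)) → Λ f ≤ φ p := by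
  let s : PointedCone ℝ (ℝ[X] × C_c(ℝ≥0, ℝ)) :=
    { carrier := {q | ∀ x : ℝ≥0, 0 ≤ q.1.eval (x : ℝ) + q.2 x}
      zero_mem' := by simp
      smul_mem' := fun c q hq x ↦ by
        have h := mul_nonneg c.2 (hq x)
        have e : (c • q).1 = (c : ℝ) • q.1 := rfl
        have e' : (c • q).2 x = (c : ℝ) * q.2 x := rfl
        rw [e, e', eval_smul, smul_eq_mul, ← mul_add]
        exact h
      add_mem' := fun {q r} hq hr x ↦ by
        have h := add_nonneg (hq x) (hr x)
        simp only [Prod.fst_add, Prod.snd_add, eval_add, CompactlySupportedContinuousMap.add_apply]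
        linarith }
  have hs : ∀ q, q ∈ s ↔ ∀ x : ℝ≥0, 0 ≤ q.1.eval (x : ℝ) + q.2 x := fun q ↦ Iff.rfl
  obtain ⟨g, hg, hg0⟩ := riesz_extension s
    ((φ.comp (LinearMap.fst ℝ ℝ[X] C_c(ℝ≥0, ℝ))).toPMap (Submodule.prod ⊤ ⊥)) (by
      rintro ⟨⟨p, f⟩, hp, hf⟩ hx
      obtain rfl : f = 0 := hf
      exact hφ p (by simpa [hs] using hx)) (by
      rintro ⟨p, f⟩
      obtain ⟨M, hM⟩ := f.hasCompactSupport.exists_bound_of_continuous f.continuous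
      refine ⟨⟨(C M - p, 0), trivial, rfl⟩, (hs _).2 fun x ↦ ?_⟩
      have := neg_le_of_abs_le (hM x)
      simp
      linarith)
  refine ⟨.mk₀ (g.comp (LinearMap.inr ℝ _ _)) fun f hf ↦ hg0 _ ((hs _).2 fun x ↦ ?_),
    fun p f hpf ↦ ?_⟩
  · simpa using hf x
  · have h1 : g (p, 0) = φ p := hg ⟨(p, 0), trivial, rfl⟩
    have h2 : 0 ≤ g (p, -f) := hg0 _ ((hs _).2 fun x ↦ by simpa using hpf x)
    have h3 : (p, -f) = (p, 0) - ((0 : ℝ[X]), f) := by simp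
    rw [h3, map_sub, h1, sub_nonneg] at h2
    exact h2

/-- The polynomial `p` on `[0, ∞)`, cut off continuously to zero on `[n, n + 1]`. -/
noncomputable def cutoffPolynomial (p : ℝ[X]) (n : ℕ) : C_c(ℝ≥0, ℝ) where
  toFun x := max 0 (min 1 (n + 1 - (x : ℝ))) * p.eval (x : ℝ)
  continuous_toFun := by fun_prop
  hasCompactSupport' := by
    refine HasCompactSupport.intro (K := Set.Icc 0 (n + 1)) isCompact_Icc fun x hx ↦ ?_
    have hx' : (n : ℝ) + 1 < x := by
      have : (n : ℝ≥0) + 1 < x := by simpa using hx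
      exact_mod_cast this
    rw [min_eq_right (by linarith), max_eq_left (by linarith), zero_mul]

lemma cutoffPolynomial_apply (p : ℝ[X]) (n : ℕ) (x : ℝ≥0) :
    cutoffPolynomial p n x = max 0 (min 1 (n + 1 - (x : ℝ))) * p.eval (x : ℝ) := rfl

lemma cutoffPolynomial_eq {p : ℝ[X]} {n : ℕ} {x : ℝ≥0} (hx : (x : ℝ) ≤ n) :
    cutoffPolynomial p n x = p.eval (x : ℝ) := by
  rw [cutoffPolynomial_apply, min_eq_left (by linarith), max_eq_right zero_le_one, one_mul]

lemma abs_cutoffPolynomial_le (p : ℝ[X]) (n : ℕ) (x : ℝ≥0) :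
    |cutoffPolynomial p n x| ≤ |p.eval (x : ℝ)| := by
  rw [cutoffPolynomial_apply, abs_mul, abs_of_nonneg (le_max_left _ _)]
  exact mul_le_of_le_one_left (abs_nonneg _) (max_le zero_le_one (min_le_left _ _))

lemma abs_sub_cutoffPolynomial_le (p : ℝ[X]) (n : ℕ) (x : ℝ≥0) :
    |p.eval (x : ℝ) - cutoffPolynomial p n x| ≤ |p.eval (x : ℝ)| := by
  have h : p.eval (x : ℝ) - cutoffPolynomial p n x =
      (1 - max 0 (min 1 (n + 1 - (x : ℝ)))) * p.eval (x : ℝ) := by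
    rw [cutoffPolynomial_apply]; ring
  have h0 : (0 : ℝ) ≤ max 0 (min 1 (n + 1 - (x : ℝ))) := le_max_left _ _
  have h1 : max 0 (min 1 (n + 1 - (x : ℝ))) ≤ 1 := max_le zero_le_one (min_le_left _ _)
  rw [h, abs_mul, abs_of_nonneg (by linarith)]
  exact mul_le_of_le_one_left (abs_nonneg _) (by linarith)

/-- Away from `[0, n]`, the polynomial `p` is dominated by `X * (p ^ 2 + 1) / n`. -/
lemma abs_sub_cutoffPolynomial_le_div (p : ℝ[X]) {n : ℕ} (hn : 0 < n) (x : ℝ≥0) :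
    |p.eval (x : ℝ) - cutoffPolynomial p n x| ≤
      ((n : ℝ)⁻¹ • (X * (p ^ 2 + 1)) : ℝ[X]).eval (x : ℝ) := by
  have hn' : (0 : ℝ) < n := by exact_mod_cast hn
  simp only [eval_smul, eval_mul, eval_X, eval_add, eval_pow, eval_one, smul_eq_mul]
  rcases le_total (x : ℝ) n with h | h
  · rw [cutoffPolynomial_eq h, sub_self, abs_zero]
    positivity
  · calc _ ≤ |p.eval (x : ℝ)| := abs_sub_cutoffPolynomial_le p n x
      _ ≤ 1 * (p.eval (x : ℝ) ^ 2 + 1) := by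
        rw [← sq_abs]; nlinarith [sq_nonneg (|p.eval (x : ℝ)| - 1), abs_nonneg (p.eval (x : ℝ))]
      _ ≤ ((n : ℝ)⁻¹ * x) * (p.eval (x : ℝ) ^ 2 + 1) := by
        gcongr
        rwa [inv_mul_eq_div, one_le_div hn']
      _ = _ := by ring

/-- **Riesz–Haviland theorem** on the half-line `[0, ∞)`. -/
theorem riesz_haviland_nnreal (φ : ℝ[X] →ₗ[ℝ] ℝ)
    (hφ : ∀ p : ℝ[X], (∀ x : ℝ≥0, 0 ≤ p.eval (x : ℝ)) → 0 ≤ φ p) :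
    ∃ σ : Measure ℝ≥0, ∀ p : ℝ[X], Integrable (fun x : ℝ≥0 ↦ p.eval (x : ℝ)) σ ∧
      ∫ x : ℝ≥0, p.eval (x : ℝ) ∂σ = φ p := by
  obtain ⟨Λ, hΛ⟩ := exists_positiveLinearMap_le φ hφ
  refine ⟨RealRMK.rieszMeasure Λ, ?_⟩
  have hnonneg : ∀ p : ℝ[X], (∀ x : ℝ≥0, 0 ≤ p.eval (x : ℝ)) →
      Integrable (fun x : ℝ≥0 ↦ p.eval (x : ℝ)) (RealRMK.rieszMeasure Λ) := by
    intro p hp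
    have hcont : Continuous fun x : ℝ≥0 ↦ p.eval (x : ℝ) := by fun_prop
    refine (aecover_Iic (tendsto_natCast_atTop_atTop (R := ℝ≥0))
      ).integrable_of_integral_bounded_of_nonneg_ae (l := atTop) (φ p) (fun n ↦ ?_)
      (.of_forall hp) (.of_forall fun n ↦ ?_)
    · rw [← Set.Icc_bot]
      exact hcont.continuousOn.integrableOn_compact isCompact_Icc
    · have hint : Integrable (cutoffPolynomial p n) (RealRMK.rieszMeasure Λ) :=
        (cutoffPolynomial p n).continuous.integrable_of_hasCompactSupport
          (cutoffPolynomial p n).hasCompactSupport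
      have hpos : ∀ x, 0 ≤ cutoffPolynomial p n x := fun x ↦
        mul_nonneg (le_max_left _ _) (hp x)
      calc ∫ x in Set.Iic (n : ℝ≥0), p.eval (x : ℝ) ∂(RealRMK.rieszMeasure Λ)
          = ∫ x in Set.Iic (n : ℝ≥0), cutoffPolynomial p n x ∂(RealRMK.rieszMeasure Λ) :=
            setIntegral_congr_fun measurableSet_Iic fun x hx ↦
              (cutoffPolynomial_eq (by exact_mod_cast hx)).symm
        _ ≤ ∫ x, cutoffPolynomial p n x ∂(RealRMK.rieszMeasure Λ) :=
            setIntegral_le_integral hint (.of_forall hpos)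
        _ = Λ (cutoffPolynomial p n) := RealRMK.integral_rieszMeasure Λ _
        _ ≤ φ p := hΛ _ _ fun x ↦ by
            simpa [abs_of_nonneg (hp x), abs_of_nonneg (hpos x)]
              using abs_cutoffPolynomial_le p n x
  intro p
  have hint : Integrable (fun x : ℝ≥0 ↦ p.eval (x : ℝ)) (RealRMK.rieszMeasure Λ) := by
    refine (hnonneg (p ^ 2 + 1) fun x ↦ ?_).mono' (by fun_prop) (.of_forall fun x ↦ ?_)
    · simp only [eval_add, eval_pow, eval_one]; positivity
    · simp only [eval_add, eval_pow, eval_one, Real.norm_eq_abs]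
      rw [← sq_abs]
      nlinarith [sq_nonneg (|p.eval (x : ℝ)| - 1), abs_nonneg (p.eval (x : ℝ))]
  refine ⟨hint, ?_⟩
  have hlim : Tendsto (fun n ↦ ∫ x, cutoffPolynomial p n x ∂(RealRMK.rieszMeasure Λ)) atTop
      (𝓝 (∫ x : ℝ≥0, p.eval (x : ℝ) ∂(RealRMK.rieszMeasure Λ))) := by
    refine tendsto_integral_of_dominated_convergence (fun x ↦ |p.eval (x : ℝ)|)
      (fun n ↦ (cutoffPolynomial p n).continuous.aestronglyMeasurable) hint.abs
      (fun n ↦ .of_forall fun x ↦ abs_cutoffPolynomial_le p n x) (.of_forall fun x ↦ ?_)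
    refine tendsto_const_nhds.congr' ?_
    filter_upwards [eventually_ge_atTop ⌈(x : ℝ)⌉₊] with n hn
    exact (cutoffPolynomial_eq (Nat.ceil_le.1 hn)).symm
  refine tendsto_nhds_unique hlim ?_
  simp only [RealRMK.integral_rieszMeasure]
  have hbound : ∀ᶠ n : ℕ in atTop,
      ‖Λ (cutoffPolynomial p n) - φ p‖ ≤ (n : ℝ)⁻¹ * φ (X * (p ^ 2 + 1)) := by
    filter_upwards [eventually_gt_atTop 0] with n hn
    have hdiff := fun x ↦ abs_le.1 (abs_sub_cutoffPolynomial_le_div p hn x)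
    have upper := hΛ (p + (n : ℝ)⁻¹ • (X * (p ^ 2 + 1))) (cutoffPolynomial p n) fun x ↦ by
      rw [eval_add]; linarith [(hdiff x).1]
    have lower := hΛ ((n : ℝ)⁻¹ • (X * (p ^ 2 + 1)) - p) (-cutoffPolynomial p n) fun x ↦ by
      rw [eval_sub, CompactlySupportedContinuousMap.neg_apply]; linarith [(hdiff x).2]
    rw [map_add, map_smul, smul_eq_mul] at upper
    rw [map_sub, map_smul, smul_eq_mul, map_neg] at lower
    rw [Real.norm_eq_abs, abs_le]
    constructor <;> linarith
  rw [tendsto_iff_norm_sub_tendsto_zero]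
  refine squeeze_zero' (.of_forall fun _ ↦ norm_nonneg _) hbound ?_
  simpa using (tendsto_inv_atTop_nhds_zero_nat (𝕜 := ℝ)).mul_const (φ (X * (p ^ 2 + 1)))

/-- The polynomial `(-1)^k L_k`. -/
noncomputable def signedLaguerre (k : ℕ) : ℝ[X] :=
  ∑ l ∈ Finset.range (k + 1),
    C ((-1 : ℝ) ^ k * ((-1 : ℝ) ^ l / (l.factorial : ℝ) * (k.choose l : ℝ))) * X ^ l

lemma laguerreFun_eq (k : ℕ) (x : ℝ) :
    laguerreFun k x = (signedLaguerre k).eval x * Real.exp (-x / 2) := by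
  simp [laguerreFun, laguerreL, signedLaguerre, eval_finsetSum, Finset.mul_sum, mul_assoc]

lemma degree_signedLaguerre (k : ℕ) : (signedLaguerre k).degree = k := by
  rw [signedLaguerre, Finset.sum_range_succ, add_comm]
  have hk : (-1 : ℝ) ^ k * ((-1 : ℝ) ^ k / (k.factorial : ℝ) * (k.choose k : ℝ)) ≠ 0 := by
    simp [Nat.factorial_ne_zero]
  rw [degree_add_eq_left_of_degree_lt, degree_C_mul_X_pow _ hk]
  rw [degree_C_mul_X_pow _ hk]
  refine (degree_sum_le _ _).trans_lt ((Finset.sup_lt_iff (WithBot.bot_lt_coe k)).2 fun l hl ↦ ?_)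
  exact (degree_C_mul_X_pow_le _ _).trans_lt (Nat.cast_lt.2 (Finset.mem_range.1 hl))

/-- The polynomials `(-1)^k L_k` as a basis of `ℝ[X]`. -/
noncomputable def laguerreBasis : Module.Basis ℕ ℝ ℝ[X] :=
  Polynomial.Sequence.basis ⟨signedLaguerre, degree_signedLaguerre⟩ fun i ↦
    (leadingCoeff_ne_zero.2 (Polynomial.Sequence.ne_zero _ i)).isUnit

lemma laguerreBasis_apply (k : ℕ) : laguerreBasis k = signedLaguerre k :=
  Polynomial.Sequence.basis_eq_self _ _ k

/-- Riesz–Haviland in the Laguerre basis: `μ` is the sequence of Laguerre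
moments of a positive Borel measure supported in `[0, ∞)` iff it pairs nonnegatively with
every truncated Laguerre series that is nonnegative on `[0, ∞)`. -/
theorem riesz_haviland_laguerre (μ : ℕ → ℝ) :
    (∃ ν : Measure ℝ, ν (Set.Iio 0) = 0 ∧
        ∀ k : ℕ, Integrable (laguerreFun k) ν ∧ μ k = ∫ x, laguerreFun k x ∂ν) ↔
    (∀ m : ℕ, ∀ g : ℕ → ℝ,
        (∀ x : ℝ, 0 ≤ x → 0 ≤ ∑ k ∈ Finset.range (m + 1), g k * laguerreFun k x) →
        0 ≤ ∑ k ∈ Finset.range (m + 1), μ k * g k) := by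
  constructor
  · rintro ⟨ν, hν, hμ⟩ m g hg
    have h : ∑ k ∈ Finset.range (m + 1), μ k * g k =
        ∫ x, ∑ k ∈ Finset.range (m + 1), g k * laguerreFun k x ∂ν := by
      rw [integral_finsetSum _ fun k _ ↦ (hμ k).1.const_mul _]
      refine Finset.sum_congr rfl fun k _ ↦ ?_
      rw [integral_const_mul, ← (hμ k).2, mul_comm]
    rw [h]
    refine integral_nonneg_of_ae ?_
    have hae : ∀ᵐ x ∂ν, x ∉ Set.Iio (0 : ℝ) := measure_eq_zero_iff_ae_notMem.1 hν
    filter_upwards [hae] with x hx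
    exact hg x (not_lt.1 hx)
  · intro h
    obtain ⟨σ, hσ⟩ := riesz_haviland_nnreal (laguerreBasis.constr ℝ μ) fun p hp ↦ by
      set c := laguerreBasis.repr p with hc
      have hsupp : c.support ⊆ Finset.range (c.support.sup id + 1) := fun k hk ↦
        Finset.mem_range_succ_iff.2 (Finset.le_sup (f := id) hk)
      have hp_sum : p = ∑ k ∈ Finset.range (c.support.sup id + 1), c k • signedLaguerre k := by
        rw [← Finsupp.sum_of_support_subset c hsupp (fun k a ↦ a • signedLaguerre k) (by simp)]
        simpa [Finsupp.linearCombination_apply, laguerreBasis_apply] using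
          (laguerreBasis.linearCombination_repr p).symm
      have hval : laguerreBasis.constr ℝ μ p =
          ∑ k ∈ Finset.range (c.support.sup id + 1), μ k * c k := by
        rw [Module.Basis.constr_apply, ← hc, Finsupp.sum_of_support_subset c hsupp _ (by simp)]
        exact Finset.sum_congr rfl fun k _ ↦ mul_comm _ _
      rw [hval]
      refine h _ c fun x hx ↦ ?_
      have hsum : ∑ k ∈ Finset.range (c.support.sup id + 1), c k * laguerreFun k x =
          p.eval x * Real.exp (-x / 2) := by
        conv_rhs => rw [hp_sum]
        simp [laguerreFun_eq, eval_finsetSum, Finset.sum_mul, mul_assoc]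
      rw [hsum]
      exact mul_nonneg (hp ⟨x, hx⟩) (Real.exp_pos _).le
    let w : ℝ≥0 → ℝ≥0 := fun x ↦ ⟨Real.exp (x / 2), (Real.exp_pos _).le⟩
    have hw : Measurable w := (by fun_prop : Continuous w).measurable
    have hemb : MeasurableEmbedding ((↑) : ℝ≥0 → ℝ) :=
      MeasurableEmbedding.subtype_coe measurableSet_Ici
    have hweight : ∀ k (x : ℝ≥0), w x • laguerreFun k x = (signedLaguerre k).eval (x : ℝ) := by
      intro k x
      change Real.exp (x / 2) * laguerreFun k x = _
      rw [laguerreFun_eq, mul_left_comm, ← Real.exp_add]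
      ring_nf
      simp
    refine ⟨(σ.withDensity fun x ↦ w x).map (↑), ?_, fun k ↦ ⟨?_, ?_⟩⟩
    · rw [hemb.map_apply]
      convert measure_empty (μ := σ.withDensity fun x ↦ w x)
      ext x
      simp
    · rw [hemb.integrable_map_iff, integrable_withDensity_iff_integrable_smul hw]
      simpa only [Function.comp_apply, hweight] using (hσ (signedLaguerre k)).1
    · rw [hemb.integral_map, integral_withDensity_eq_integral_smul hw]
      simp only [hweight]
      rw [(hσ (signedLaguerre k)).2, ← laguerreBasis_apply, Module.Basis.constr_basis]
end

section
/- For all integers m ≥ n ≥ 1, strong duality holds between the semidefinite programs (SDP^{m,≤}_n) and (D-SDP^{m,≤}_n): the supremum of F_n over all feasible pairs (Q, F) of the primal program equals the infimum of y over all feasible triples (A, μ, y) of the dual program. -/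
section StrongDuality

open Finset Matrix

section Transform

/-- The coefficient of `F k` in the degree-`2l` constraint: up to the sign `(-1)^k`, the
coefficient of `x ^ l` in the `k`-th Laguerre polynomial. -/
noncomputable def laguerreCoeff (k l : ℕ) : ℝ :=
  (-1 : ℝ) ^ (k + l) / (l.factorial : ℝ) * (k.choose l : ℝ)

/-- The multipliers `μ` determined by the even entries of a sequence `h`. -/
noncomputable def laguerreTransform (h : ℕ → ℝ) (k : ℕ) : ℝ :=
  ∑ l ∈ range (k + 1), laguerreCoeff k l * h (2 * l)

lemma laguerreCoeff_eq_zero {k l : ℕ} (hkl : k < l) : laguerreCoeff k l = 0 := by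
  simp [laguerreCoeff, Nat.choose_eq_zero_of_lt hkl]

lemma sum_laguerreTransform_mul_choose (h : ℕ → ℝ) (l : ℕ) :
    ∑ k ∈ range (l + 1), laguerreTransform h k * (l.choose k : ℝ) * (l.factorial : ℝ) =
      h (2 * l) := by
  set f : ℕ → ℝ := fun l => h (2 * l) / (l.factorial : ℝ) with hf
  have hΔ : ∀ k, (fwdDiff 1)^[k] f 0 = laguerreTransform h k := by
    intro k
    rw [fwdDiff_iter_eq_sum_shift]
    refine sum_congr rfl fun j hj => ?_
    have hjk : j ≤ k := by simpa [Nat.lt_succ_iff] using hj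
    have hsign : (-1 : ℝ) ^ (k + j) = (-1) ^ (k - j) := by
      obtain ⟨d, rfl⟩ := Nat.exists_eq_add_of_le hjk
      rw [Nat.add_sub_cancel_left, show j + d + j = 2 * j + d by ring, pow_add, pow_mul]
      simp
    simp only [laguerreCoeff, hsign, hf, zsmul_eq_mul, zero_add, smul_eq_mul, mul_one]
    push_cast
    ring
  have hN := shift_eq_sum_fwdDiff_iter 1 f l 0
  simp only [hΔ, zero_add, smul_eq_mul, mul_one, nsmul_eq_mul] at hN
  have hl : (l.factorial : ℝ) ≠ 0 := by exact_mod_cast l.factorial_ne_zero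
  rw [← sum_mul, eq_comm, ← div_eq_iff hl]
  exact hN.trans (sum_congr rfl fun k _ => mul_comm _ _)

lemma laguerreTransform_eq {h μ : ℕ → ℝ} (m : ℕ)
    (hμ : ∀ l ≤ m, h (2 * l) =
      ∑ k ∈ range (l + 1), μ k * (l.choose k : ℝ) * (l.factorial : ℝ)) :
    ∀ k ≤ m, laguerreTransform h k = μ k := by
  intro k
  induction k using Nat.strong_induction_on with
  | _ k ih =>
    intro hk
    have hs := (sum_laguerreTransform_mul_choose h k).trans (hμ k hk)
    have hlow : ∑ j ∈ range k, laguerreTransform h j * (k.choose j : ℝ) * (k.factorial : ℝ) =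
        ∑ j ∈ range k, μ j * (k.choose j : ℝ) * (k.factorial : ℝ) :=
      sum_congr rfl fun j hj => by
        rw [ih j (mem_range.1 hj) ((mem_range.1 hj).le.trans hk)]
    rw [sum_range_succ, sum_range_succ, hlow] at hs
    have hk0 : (k.factorial : ℝ) ≠ 0 := by exact_mod_cast k.factorial_ne_zero
    simpa [hk0] using hs

end Transform

section ConstraintDefect

variable {m : ℕ}

/-- The defect of `(Q, F)` in the primal constraint of degree `s`. -/
noncomputable def constraintDefect (Q : Matrix (Fin (m + 1)) (Fin (m + 1)) ℝ) (F : ℕ → ℝ) (s : ℕ) : ℝ :=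
  (∑ i : Fin (m + 1), ∑ j : Fin (m + 1), if i.val + j.val = s then Q i j else 0) -
    if Even s then ∑ k ∈ range (m + 1), laguerreCoeff k (s / 2) * F k else 0

lemma sum_range_mul_ite_even (h g : ℕ → ℝ) (m : ℕ) :
    ∑ s ∈ range (2 * m + 1), h s * (if Even s then g (s / 2) else 0) =
      ∑ l ∈ range (m + 1), h (2 * l) * g l := by
  induction m with
  | zero => simp
  | succ m ih =>
    rw [show 2 * (m + 1) + 1 = 2 * m + 1 + 1 + 1 by ring, sum_range_succ, sum_range_succ, ih,
      sum_range_succ _ (m + 1)]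
    have h1 : ¬ Even (2 * m + 1) := by simp
    have h2 : Even (2 * m + 1 + 1) := ⟨m + 1, by ring⟩
    rw [if_neg h1, if_pos h2, show 2 * m + 1 + 1 = 2 * (m + 1) by ring]
    simp

lemma sum_mul_constraintDefect (Q : Matrix (Fin (m + 1)) (Fin (m + 1)) ℝ) (F h : ℕ → ℝ) :
    ∑ s ∈ range (2 * m + 1), h s * constraintDefect Q F s =
      (∑ i, ∑ j, h (i.val + j.val) * Q i j) -
        ∑ k ∈ range (m + 1), F k * laguerreTransform h k := by
  simp only [constraintDefect, mul_sub, sum_sub_distrib]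
  congr 1
  · simp only [mul_sum]
    rw [sum_comm]
    refine sum_congr rfl fun i _ => ?_
    rw [sum_comm]
    refine sum_congr rfl fun j _ => ?_
    rw [sum_eq_single (i.val + j.val)]
    · simp
    · intro s _ hs
      simp [Ne.symm hs]
    · intro hs
      exact absurd (mem_range.2 (by omega)) hs
  · rw [sum_range_mul_ite_even h (fun l => ∑ k ∈ range (m + 1), laguerreCoeff k l * F k)]
    simp only [mul_sum]
    rw [sum_comm]
    refine sum_congr rfl fun k hk => ?_
    rw [laguerreTransform, mul_sum]
    have hkm : range (k + 1) ⊆ range (m + 1) :=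
      range_subset_range.2 (Nat.succ_le_of_lt (mem_range.1 hk))
    rw [← sum_subset hkm]
    · exact sum_congr rfl fun l _ => by ring
    · intro l _ hl
      rw [laguerreCoeff_eq_zero (by simpa [Nat.lt_succ_iff] using hl)]
      ring

lemma sum_Icc_eq_sum_laguerreCoeff (F : ℕ → ℝ) (l : ℕ) :
    ∑ k ∈ Icc l m, ((-1 : ℝ) ^ (k + l) / (l.factorial : ℝ)) * (k.choose l : ℝ) * F k =
      ∑ k ∈ range (m + 1), laguerreCoeff k l * F k := by
  refine sum_subset (fun k hk => ?_) fun k hk hkl => ?_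
  · simp only [mem_Icc, mem_range] at *
    omega
  · have : k < l := by
      simp only [mem_Icc, mem_range] at *
      omega
    rw [Nat.choose_eq_zero_of_lt this]
    simp

/-- The antidiagonal constraints of the primal program say that all defects vanish. -/
lemma constraintDefect_eq_zero_iff (Q : Matrix (Fin (m + 1)) (Fin (m + 1)) ℝ) (F : ℕ → ℝ) :
    (∀ s < 2 * m + 1, constraintDefect Q F s = 0) ↔
      (∀ l, 1 ≤ l → l ≤ m →
        (∑ i : Fin (m + 1), ∑ j : Fin (m + 1),
          if i.val + j.val = 2 * l - 1 then Q i j else 0) = 0) ∧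
      (∀ l ≤ m,
        (∑ i : Fin (m + 1), ∑ j : Fin (m + 1),
          if i.val + j.val = 2 * l then Q i j else 0)
        = ∑ k ∈ Icc l m,
            ((-1 : ℝ) ^ (k + l) / (l.factorial : ℝ)) * (k.choose l : ℝ) * F k) := by
  simp only [sum_Icc_eq_sum_laguerreCoeff]
  constructor
  · intro h
    refine ⟨fun l hl hlm => ?_, fun l hlm => ?_⟩
    · have hodd : ¬ Even (2 * l - 1) := by
        rw [Nat.even_iff]
        omega
      have := h (2 * l - 1) (by omega)
      rwa [constraintDefect, if_neg hodd, sub_zero] at this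
    · have := h (2 * l) (by omega)
      rwa [constraintDefect, if_pos (even_two_mul l), Nat.mul_div_cancel_left l two_pos,
        sub_eq_zero] at this
  · rintro ⟨hodd, heven⟩ s hs
    rcases Nat.even_or_odd' s with ⟨l, rfl | rfl⟩
    · rw [constraintDefect, if_pos (even_two_mul l), Nat.mul_div_cancel_left l two_pos, sub_eq_zero]
      exact heven l (by omega)
    · rw [constraintDefect, if_neg (by simp), sub_zero]
      exact hodd (l + 1) (by omega) (by omega)

end ConstraintDefect

section PosSemidef

variable {ι : Type*} [Fintype ι]

lemma Matrix.PosSemidef.sum_mul_nonneg [DecidableEq ι] {A Q : Matrix ι ι ℝ}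
    (hA : A.PosSemidef) (hQ : Q.PosSemidef) : 0 ≤ ∑ i, ∑ j, A i j * Q i j := by
  have h := (hA.hadamard hQ).dotProduct_mulVec_nonneg 1
  simpa [dotProduct, mulVec] using h

lemma Matrix.PosSemidef.abs_apply_le_trace [DecidableEq ι] {P : Matrix ι ι ℝ}
    (hP : P.PosSemidef) (i j : ι) : |P i j| ≤ P.trace := by
  have hdiag : ∀ k, 0 ≤ P k k := fun k => hP.diag_nonneg
  have hle : ∀ k, P k k ≤ P.trace := fun k =>
    Finset.single_le_sum (f := fun k => P k k) (fun k _ => hdiag k) (Finset.mem_univ k)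
  have hsymm : P j i = P i j := by simpa using hP.isHermitian.apply i j
  have hadd := hP.dotProduct_mulVec_nonneg (Pi.single i 1 + Pi.single j 1)
  have hsub := hP.dotProduct_mulVec_nonneg (Pi.single i 1 - Pi.single j 1)
  simp only [star_trivial, mulVec_add, mulVec_sub, add_dotProduct, sub_dotProduct,
    dotProduct_add, dotProduct_sub, mulVec_single_one, single_one_dotProduct, col_apply] at hadd hsub
  rw [abs_le]
  constructor <;> linarith [hle i, hle j]

lemma Matrix.isClosed_setOf_posSemidef : IsClosed {P : Matrix ι ι ℝ | P.PosSemidef} := by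
  simp only [posSemidef_iff_dotProduct_mulVec, Set.ofPred_and, Set.ofPred_forall]
  refine IsClosed.inter (isClosed_eq (by fun_prop) continuous_id) ?_
  refine isClosed_iInter fun x => isClosed_le continuous_const (by fun_prop)

lemma Matrix.isCompact_setOf_posSemidef_trace_le [DecidableEq ι] (R : ℝ) :
    IsCompact {P : Matrix ι ι ℝ | P.PosSemidef ∧ P.trace ≤ R} := by
  have hbox : IsCompact (Set.univ.pi fun _ : ι => Set.univ.pi fun _ : ι => Set.Icc (-R) R) :=
    isCompact_univ_pi fun _ => isCompact_univ_pi fun _ => isCompact_Icc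
  refine IsCompact.of_isClosed_subset (X := ι → ι → ℝ) hbox ?_ ?_
  · have htr : Continuous fun P : Matrix ι ι ℝ => P.trace := by fun_prop
    exact isClosed_setOf_posSemidef.inter (isClosed_le htr continuous_const)
  · rintro P ⟨hP, hR⟩ i - j -
    exact abs_le.1 ((hP.abs_apply_le_trace i j).trans hR)

lemma Matrix.sum_transpose_mul_self_mul (V Q : Matrix ι ι ℝ) :
    ∑ i, ∑ j, (Vᵀ * V) i j * Q i j = (V * Q * Vᵀ).trace := by
  simp only [trace, diag_apply, mul_apply, transpose_apply, Finset.sum_mul]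
  rw [Finset.sum_comm]
  conv_rhs => rw [Finset.sum_comm]
  refine Finset.sum_congr rfl fun j _ => ?_
  rw [Finset.sum_comm]
  exact Finset.sum_congr rfl fun t _ => Finset.sum_congr rfl fun i _ => by ring

lemma Matrix.isCompact_setOf_posSemidef_sum_mul_le [DecidableEq ι] {V : Matrix ι ι ℝ}
    (hV : IsUnit V.det) (R : ℝ) :
    IsCompact {Q : Matrix ι ι ℝ | Q.PosSemidef ∧ ∑ i, ∑ j, (Vᵀ * V) i j * Q i j ≤ R} := by
  have hV' : IsUnit Vᵀ.det := by rwa [det_transpose]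
  have himage : {Q : Matrix ι ι ℝ | Q.PosSemidef ∧ ∑ i, ∑ j, (Vᵀ * V) i j * Q i j ≤ R} =
      (fun P => V⁻¹ * P * (V⁻¹)ᵀ) '' {P : Matrix ι ι ℝ | P.PosSemidef ∧ P.trace ≤ R} := by
    ext Q
    simp only [sum_transpose_mul_self_mul, Set.mem_ofPred_eq, Set.mem_image]
    constructor
    · rintro ⟨hQ, hR⟩
      refine ⟨V * Q * Vᵀ, ⟨by simpa using hQ.mul_mul_conjTranspose_same V, hR⟩, ?_⟩
      rw [transpose_nonsing_inv, ← Matrix.mul_assoc, mul_nonsing_inv_cancel_right _ _ hV',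
        nonsing_inv_mul_cancel_left _ _ hV]
    · rintro ⟨P, ⟨hP, hR⟩, rfl⟩
      refine ⟨by simpa using hP.mul_mul_conjTranspose_same V⁻¹, ?_⟩
      rwa [transpose_nonsing_inv, ← Matrix.mul_assoc, nonsing_inv_mul_cancel_right _ _ hV',
        mul_nonsing_inv_cancel_left _ _ hV]
  rw [himage]
  exact (isCompact_setOf_posSemidef_trace_le R).image (by fun_prop)

end PosSemidef

section Duality

variable {m n : ℕ}

lemma primal_value_le_dual_value (hmn : n ≤ m)
    {Q : Matrix (Fin (m + 1)) (Fin (m + 1)) ℝ} {F : ℕ → ℝ} (hQ : Q.PosSemidef)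
    (hF1 : ∑ k ∈ range (m + 1), F k = 1) (hF0 : ∀ k ≤ m, 0 ≤ F k)
    (hd : ∀ s < 2 * m + 1, constraintDefect Q F s = 0)
    {A : Matrix (Fin (m + 1)) (Fin (m + 1)) ℝ} {μ : ℕ → ℝ} {y : ℝ} (hA : A.PosSemidef)
    (hn : 1 + μ n ≤ y) (hμ : ∀ k ≤ m, μ k ≤ y)
    (hAμ : ∀ (i j : Fin (m + 1)) (l : ℕ), i.val + j.val = 2 * l →
      A i j = ∑ k ∈ range (l + 1), μ k * (l.choose k : ℝ) * (l.factorial : ℝ)) :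
    F n ≤ y := by
  set a : ℕ → ℝ := fun l =>
    ∑ k ∈ range (l + 1), μ k * (l.choose k : ℝ) * (l.factorial : ℝ) with ha
  set h : ℕ → ℝ := fun s => if Even s then a (s / 2) else 0 with hh
  set D : Matrix (Fin (m + 1)) (Fin (m + 1)) ℝ := diagonal fun i => (-1 : ℝ) ^ i.val with hD
  -- Conjugating by the signs `(-1)^i` and averaging removes the odd entries of `A`.
  have hA' : (D * A * D).PosSemidef := by
    simpa [hD] using hA.mul_mul_conjTranspose_same D
  have hentry : ∀ i j : Fin (m + 1), 2 * h (i.val + j.val) = A i j + (D * A * D) i j := by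
    intro i j
    have hDA : (D * A * D) i j = (-1 : ℝ) ^ (i.val + j.val) * A i j := by
      simp only [hD, mul_diagonal, diagonal_mul, pow_add]
      ring
    rw [hDA]
    rcases Nat.even_or_odd' (i.val + j.val) with ⟨l, hl | hl⟩
    · have hAij : A i j = a l := hAμ i j l hl
      simp [hh, hl, hAij]
      ring
    · simp [hh, hl, pow_add, pow_mul]
  have hpos : 0 ≤ ∑ i : Fin (m + 1), ∑ j : Fin (m + 1), h (i.val + j.val) * Q i j := by
    have h2 : 2 * ∑ i : Fin (m + 1), ∑ j : Fin (m + 1), h (i.val + j.val) * Q i j =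
        (∑ i, ∑ j, A i j * Q i j) + ∑ i, ∑ j, (D * A * D) i j * Q i j := by
      simp only [mul_sum, ← sum_add_distrib, ← mul_assoc, hentry, add_mul]
    linarith [hA.sum_mul_nonneg hQ, hA'.sum_mul_nonneg hQ]
  have hlt : ∀ k ≤ m, laguerreTransform h k = μ k :=
    laguerreTransform_eq m fun l _ => by simp [hh, ha]
  have hsum := sum_mul_constraintDefect Q F h
  rw [sum_eq_zero fun s hs => by rw [hd s (mem_range.1 hs), mul_zero]] at hsum
  have hbound : ∑ k ∈ range (m + 1), F k * laguerreTransform h k + F n ≤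
      ∑ k ∈ range (m + 1), F k * y := by
    have hFn : F n = ∑ k ∈ range (m + 1), F k * (if k = n then 1 else 0) := by
      simp [hmn]
    rw [hFn, ← sum_add_distrib]
    refine sum_le_sum fun k hk => ?_
    have hkm : k ≤ m := Nat.lt_succ_iff.1 (mem_range.1 hk)
    rw [← mul_add, hlt k hkm]
    refine mul_le_mul_of_nonneg_left ?_ (hF0 k hkm)
    split_ifs with hkn
    · subst hkn
      linarith
    · linarith [hμ k hkm]
  rw [← sum_mul, hF1, one_mul] at hbound
  linarith

lemma constraintDefect_single (s : ℕ) :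
    constraintDefect (m := m) (Matrix.single 0 0 1) (Pi.single 0 1) s = 0 := by
  have hQ : (∑ i : Fin (m + 1), ∑ j : Fin (m + 1),
      if i.val + j.val = s then (Matrix.single 0 0 1 : Matrix _ _ ℝ) i j else 0) =
      if s = 0 then 1 else 0 := by
    rw [sum_eq_single 0, sum_eq_single 0]
    · simp [eq_comm]
    · intro j _ hj
      simp [Ne.symm hj]
    · simp
    · intro i _ hi
      simp [Ne.symm hi]
    · simp
  have hF : ∑ k ∈ range (m + 1), laguerreCoeff k (s / 2) * (Pi.single 0 1 : ℕ → ℝ) k =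
      laguerreCoeff 0 (s / 2) := by
    rw [sum_eq_single 0 (fun k _ hk => by simp [hk]) (by simp)]
    simp
  rw [constraintDefect, hQ, hF]
  rcases Nat.even_or_odd' s with ⟨l, rfl | rfl⟩
  · rcases Nat.eq_zero_or_pos l with rfl | hl
    · simp [laguerreCoeff]
    · simp [laguerreCoeff_eq_zero hl, hl.ne']
  · simp

lemma posSemidef_single_zero :
    (Matrix.single 0 0 1 : Matrix (Fin (m + 1)) (Fin (m + 1)) ℝ).PosSemidef := by
  rw [← Matrix.diagonal_single]
  exact PosSemidef.diagonal (by simp)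

/-- The defects and the objective value, as a linear map. -/
noncomputable def defectValueMap (m n : ℕ) :
    Matrix (Fin (m + 1)) (Fin (m + 1)) ℝ × (ℕ → ℝ) →ₗ[ℝ] (Fin (2 * m + 1) → ℝ) × ℝ where
  toFun p := (fun s => constraintDefect p.1 p.2 s, p.2 n)
  map_add' p q := by
    ext s
    · simp only [constraintDefect, Prod.fst_add, Prod.snd_add, Matrix.add_apply, Pi.add_apply,
        mul_add, sum_add_distrib, ite_add_zero]
      ring
    · simp
  map_smul' c p := by
    ext s
    · simp only [constraintDefect, Prod.smul_fst, Prod.smul_snd, Matrix.smul_apply,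
        Pi.smul_apply, smul_eq_mul, RingHom.id_apply, mul_sub, mul_sum, mul_ite, mul_zero,
        mul_left_comm c]
    · simp

lemma continuous_defectValueMap : Continuous (defectValueMap m n) := by
  refine Continuous.prodMk (continuous_pi fun s => ?_) (by fun_prop)
  refine Continuous.sub ?_ ?_
  · refine continuous_finsetSum _ fun i _ => continuous_finsetSum _ fun j _ => ?_
    split_ifs <;> fun_prop
  · split_ifs <;> fun_prop

lemma laguerreTransform_combination (a b : ℝ) (g h : ℕ → ℝ) (k : ℕ) :
    laguerreTransform (fun s => a * g s + b * h s) k =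
      a * laguerreTransform g k + b * laguerreTransform h k := by
  simp only [laguerreTransform, mul_sum, ← sum_add_distrib]
  exact sum_congr rfl fun l _ => by ring

lemma ContinuousLinearMap.apply_pi_prod_eq_sum (N : ℕ) (f : ((Fin N → ℝ) × ℝ) →L[ℝ] ℝ) :
    ∃ h : ℕ → ℝ, ∀ (x : ℕ → ℝ) (r : ℝ),
      f (fun s => x s, r) = ∑ s ∈ range N, h s * x s + f (0, 1) * r := by
  refine ⟨fun s => if hs : s < N then f (Pi.single ⟨s, hs⟩ 1, 0) else 0, fun x r => ?_⟩
  have hx : ((fun s : Fin N => x s, r) : (Fin N → ℝ) × ℝ) =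
      ∑ s : Fin N, x s • ((Pi.single s 1, 0) : (Fin N → ℝ) × ℝ) + r • ((0, 1) : _ × ℝ) := by
    ext s
    · simp [Prod.fst_sum, Finset.sum_apply, Pi.single_apply]
    · simp [Prod.snd_sum]
  rw [hx, map_add, map_sum, map_smul, ← Fin.sum_univ_eq_sum_range]
  simp only [map_smul, smul_eq_mul, Fin.is_lt, dite_true, Fin.eta, mul_comm]

/-- If `c * b < s` for every scale `c ≥ 0` with `c * q ≤ R`, then `b` is dominated by `q`. -/
lemma le_div_mul_of_forall_scale {q b s R : ℝ} (hq : 0 ≤ q) (hs : 0 < s) (hR : 0 < R)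
    (h : ∀ c, 0 ≤ c → c * q ≤ R → c * b < s) : b ≤ s / R * q := by
  rcases hq.eq_or_lt with rfl | hq
  · by_contra! hb
    rw [mul_zero] at hb
    have := h (s / b) (by positivity) (by simpa using hR.le)
    rw [div_mul_cancel₀ _ hb.ne'] at this
    exact lt_irrefl _ this
  · have := h (R / q) (by positivity) (by rw [div_mul_cancel₀ _ hq.ne'])
    rw [div_mul_eq_mul_div, div_lt_iff₀ hq] at this
    rw [div_mul_eq_mul_div, le_div_iff₀ hR]
    linarith

lemma exists_dual_feasible (hn : 1 ≤ n) (hmn : n ≤ m) {w : ℝ} (hw0 : 0 < w)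
    (hw : ∀ (Q : Matrix (Fin (m + 1)) (Fin (m + 1)) ℝ) (F : ℕ → ℝ), Q.PosSemidef →
      ∑ k ∈ range (m + 1), F k = 1 → (∀ k ≤ m, 0 ≤ F k) →
      (∀ s < 2 * m + 1, constraintDefect Q F s = 0) → F n ≠ w) :
    ∃ (A : Matrix (Fin (m + 1)) (Fin (m + 1)) ℝ) (μ : ℕ → ℝ),
      A.PosSemidef ∧ 1 + μ n ≤ w ∧ (∀ k ≤ m, μ k ≤ w) ∧
      ∀ (i j : Fin (m + 1)) (l : ℕ), i.val + j.val = 2 * l →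
        A i j = ∑ k ∈ range (l + 1), μ k * (l.choose k : ℝ) * (l.factorial : ℝ) := by
  -- A positive definite Hankel matrix, the moment matrix of the points `0, …, m`.
  set V : Matrix (Fin (m + 1)) (Fin (m + 1)) ℝ := vandermonde fun i => (i.val : ℝ) with hV
  have hVdet : IsUnit V.det := isUnit_iff_ne_zero.2 <|
    det_vandermonde_ne_zero_iff.2 fun i j hij => Fin.ext (by exact_mod_cast hij)
  set g : ℕ → ℝ := fun s => ∑ t : Fin (m + 1), (t.val : ℝ) ^ s with hg
  have hVg : ∀ i j, (Vᵀ * V) i j = g (i.val + j.val) := fun i j => by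
    simp [hV, hg, mul_apply, vandermonde_apply, pow_add]
  obtain ⟨R, hR, hgR⟩ : ∃ R : ℝ, 0 < R ∧ ∀ k ≤ m, laguerreTransform g k ≤ R := by
    refine ⟨1 + ∑ k ∈ range (m + 1), |laguerreTransform g k|, by positivity, fun k hk => ?_⟩
    have := single_le_sum (f := fun k => |laguerreTransform g k|) (fun k _ => abs_nonneg _)
      (mem_range.2 (Nat.lt_succ_iff.2 hk))
    linarith [le_abs_self (laguerreTransform g k)]
  set SQ : Set (Matrix (Fin (m + 1)) (Fin (m + 1)) ℝ) :=
    {Q | Q.PosSemidef ∧ ∑ i, ∑ j, (Vᵀ * V) i j * Q i j ≤ R} with hSQ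
  set SF : Set (ℕ → ℝ) :=
    (Set.univ.pi fun _ => Set.Icc 0 1) ∩ {F | ∑ k ∈ range (m + 1), F k = 1} with hSF
  have hSQc : IsCompact SQ := isCompact_setOf_posSemidef_sum_mul_le hVdet R
  have hSFc : IsCompact SF :=
    (isCompact_univ_pi fun _ => isCompact_Icc).inter_right
      (isClosed_eq (by fun_prop) continuous_const)
  have hSQconv : Convex ℝ SQ := by
    rintro P ⟨hP, hPR⟩ Q ⟨hQ, hQR⟩ a b ha hb hab
    refine ⟨(hP.smul ha).add (hQ.smul hb), ?_⟩
    have hlin : ∑ i, ∑ j, (Vᵀ * V) i j * (a • P + b • Q) i j =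
        a * (∑ i, ∑ j, (Vᵀ * V) i j * P i j) + b * ∑ i, ∑ j, (Vᵀ * V) i j * Q i j := by
      simp only [mul_sum, ← sum_add_distrib]
      refine sum_congr rfl fun i _ => sum_congr rfl fun j _ => ?_
      simp
      ring
    rw [hlin]
    have hR' : R = a * R + b * R := by rw [← add_mul, hab, one_mul]
    rw [hR']
    gcongr
  have hSFconv : Convex ℝ SF := by
    refine (convex_pi fun _ _ => convex_Icc 0 1).inter ?_
    intro F hF G hG a b _ _ hab
    have hF' : ∑ k ∈ range (m + 1), F k = 1 := hF
    have hG' : ∑ k ∈ range (m + 1), G k = 1 := hG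
    show ∑ k ∈ range (m + 1), (a • F + b • G) k = 1
    simp [sum_add_distrib, ← mul_sum, hF', hG', hab]
  have hsingle : ∀ k ≤ m, (Pi.single k 1 : ℕ → ℝ) ∈ SF := by
    intro k hk
    refine ⟨fun j _ => ?_, ?_⟩
    · rcases eq_or_ne j k with rfl | hjk <;> simp [*]
    · show ∑ j ∈ range (m + 1), (Pi.single k 1 : ℕ → ℝ) j = 1
      simp [Pi.single_apply, hk]
  have hbound : ∀ Q F, F ∈ SF → (∀ s < 2 * m + 1, constraintDefect Q F s = 0) →
      ∑ i, ∑ j, (Vᵀ * V) i j * Q i j ≤ R := by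
    rintro Q F ⟨hF, hF1⟩ hd
    have hsum := sum_mul_constraintDefect Q F g
    rw [sum_eq_zero fun s hs => by rw [hd s (mem_range.1 hs), mul_zero]] at hsum
    have hF1' : ∑ k ∈ range (m + 1), F k = 1 := hF1
    calc ∑ i, ∑ j, (Vᵀ * V) i j * Q i j
        = ∑ k ∈ range (m + 1), F k * laguerreTransform g k := by
          simp only [hVg]
          linarith
      _ ≤ ∑ k ∈ range (m + 1), F k * R := sum_le_sum fun k hk =>
          mul_le_mul_of_nonneg_left (hgR k (Nat.lt_succ_iff.1 (mem_range.1 hk)))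
            (hF k trivial).1
      _ = R := by rw [← sum_mul, hF1', one_mul]
  have hnot : ((0, w) : (Fin (2 * m + 1) → ℝ) × ℝ) ∉ defectValueMap m n '' (SQ ×ˢ SF) := by
    rintro ⟨⟨Q, F⟩, ⟨hQ, hF⟩, hQF⟩
    refine hw Q F hQ.1 hF.2 (fun k _ => (hF.1 k trivial).1) (fun s hs => ?_)
      (congrArg Prod.snd hQF)
    exact congrFun (congrArg Prod.fst hQF) ⟨s, hs⟩
  obtain ⟨f, u, hfu, huf⟩ := geometric_hahn_banach_closed_point
    ((hSQconv.prod hSFconv).linear_image (defectValueMap m n))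
    ((hSQc.prod hSFc).image continuous_defectValueMap).isClosed hnot
  obtain ⟨h, hfh⟩ := ContinuousLinearMap.apply_pi_prod_eq_sum _ f
  set t := f (0, 1) with ht
  have hfw : f (0, w) = t * w := by
    have h0 := hfh 0 w
    simp only [Pi.zero_apply, mul_zero, sum_const_zero, zero_add] at h0
    exact h0
  have hsep : ∀ Q ∈ SQ, ∀ F ∈ SF,
      (∑ i : Fin (m + 1), ∑ j : Fin (m + 1), h (i.val + j.val) * Q i j) -
        ∑ k ∈ range (m + 1), F k * laguerreTransform h k + t * F n < t * w := by
    intro Q hQ F hF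
    rw [← sum_mul_constraintDefect, ← hfh, ← hfw]
    exact (hfu _ ⟨(Q, F), ⟨hQ, hF⟩, rfl⟩).trans huf
  have htpos : 0 < t := by
    have h0 := hsep (Matrix.single 0 0 1) ⟨posSemidef_single_zero,
      hbound _ _ (hsingle 0 m.zero_le) fun s _ => constraintDefect_single s⟩
      (Pi.single 0 1) (hsingle 0 m.zero_le)
    rw [← sum_mul_constraintDefect, Pi.single_eq_of_ne (by omega : n ≠ 0)] at h0
    simp only [constraintDefect_single, mul_zero, sum_const_zero, add_zero] at h0
    exact pos_of_mul_pos_left h0 hw0.le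
  set v : ℕ → ℝ := fun k => t * (Pi.single k 1 : ℕ → ℝ) n - laguerreTransform h k with hv
  have hsepv : ∀ Q ∈ SQ, ∀ k ≤ m,
      (∑ i : Fin (m + 1), ∑ j : Fin (m + 1), h (i.val + j.val) * Q i j) + v k < t * w := by
    intro Q hQ k hk
    have := hsep Q hQ _ (hsingle k hk)
    have hk' : ∑ j ∈ range (m + 1), (Pi.single k 1 : ℕ → ℝ) j * laguerreTransform h j =
        laguerreTransform h k := by
      simp [Pi.single_apply, hk]
    rw [hk'] at this
    simp only [hv]
    linarith
  obtain ⟨k₀, hk₀, hmax⟩ := exists_max_image (range (m + 1)) v ⟨0, by simp⟩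
  have hk₀m : k₀ ≤ m := Nat.lt_succ_iff.1 (mem_range.1 hk₀)
  set σ : ℝ := t * w - v k₀ with hσ
  have hσpos : 0 < σ := by
    have := hsepv 0 ⟨.zero, by simpa using hR.le⟩ k₀ hk₀m
    simp only [Matrix.zero_apply, mul_zero, sum_const_zero, zero_add] at this
    linarith
  set h' : ℕ → ℝ := fun s => (σ / R / t) * g s + (-1 / t) * h s with hh'
  have hμ : ∀ k ≤ m, laguerreTransform h' k + (Pi.single k 1 : ℕ → ℝ) n ≤ w := by
    intro k hk
    rw [hh', laguerreTransform_combination]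
    have h1 : σ / R * laguerreTransform g k ≤ σ := by
      calc σ / R * laguerreTransform g k ≤ σ / R * R :=
            mul_le_mul_of_nonneg_left (hgR k hk) (by positivity)
        _ = σ := div_mul_cancel₀ _ hR.ne'
    have h2 : v k ≤ v k₀ := hmax k (mem_range.2 (Nat.lt_succ_iff.2 hk))
    have h3 : σ / R / t * laguerreTransform g k + -1 / t * laguerreTransform h k +
        (Pi.single k 1 : ℕ → ℝ) n = (σ / R * laguerreTransform g k + v k) / t := by
      simp only [hv]
      field_simp
      ring
    rw [h3, div_le_iff₀ htpos]
    linarith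
  refine ⟨Matrix.of fun i j => h' (i.val + j.val), laguerreTransform h', ?_, ?_, ?_, ?_⟩
  · refine PosSemidef.of_dotProduct_mulVec_nonneg ?_ fun x => ?_
    · ext i j
      simp [add_comm]
    have hform : ∀ H : ℕ → ℝ, ∀ c : ℝ,
        ∑ i : Fin (m + 1), ∑ j : Fin (m + 1), H (i.val + j.val) * (c • vecMulVec x (star x)) i j =
          c * ∑ i : Fin (m + 1), ∑ j : Fin (m + 1), H (i.val + j.val) * (x i * x j) := by
      intro H c
      simp only [mul_sum, Matrix.smul_apply, vecMulVec_apply, smul_eq_mul, star_trivial,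
        mul_left_comm c]
    have hxx := posSemidef_vecMulVec_self_star x
    have hq : 0 ≤ ∑ i : Fin (m + 1), ∑ j : Fin (m + 1), g (i.val + j.val) * (x i * x j) := by
      have hVV : (Vᵀ * V).PosSemidef := by simpa using posSemidef_conjTranspose_mul_self V
      have := hVV.sum_mul_nonneg hxx
      simpa only [hVg, vecMulVec_apply, star_trivial] using this
    have hle := le_div_mul_of_forall_scale
      (b := ∑ i : Fin (m + 1), ∑ j : Fin (m + 1), h (i.val + j.val) * (x i * x j))
      hq hσpos hR fun c hc hcq => by
        have := hsepv (c • vecMulVec x (star x))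
          ⟨hxx.smul hc, by simpa only [hVg, hform g c] using hcq⟩ k₀ hk₀m
        rw [hform h c] at this
        linarith
    have hsplit : star x ⬝ᵥ (Matrix.of fun i j : Fin (m + 1) => h' (i.val + j.val)) *ᵥ x =
        (σ / R * (∑ i : Fin (m + 1), ∑ j : Fin (m + 1), g (i.val + j.val) * (x i * x j)) -
          ∑ i : Fin (m + 1), ∑ j : Fin (m + 1), h (i.val + j.val) * (x i * x j)) / t := by
      simp only [dotProduct, mulVec, mul_sum, sum_div, ← sum_sub_distrib, star_trivial, of_apply]
      refine sum_congr rfl fun i _ => sum_congr rfl fun j _ => ?_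
      simp only [hh']
      ring
    rw [hsplit]
    exact div_nonneg (sub_nonneg.2 hle) htpos.le
  · have := hμ n hmn
    rw [Pi.single_eq_same] at this
    linarith
  · intro k hk
    have h0 : 0 ≤ (Pi.single k 1 : ℕ → ℝ) n := ((hsingle k hk).1 n trivial).1
    linarith [hμ k hk]
  · intro i j l hl
    rw [sum_laguerreTransform_mul_choose, of_apply, hl]

end Duality

end StrongDuality


/-- strong duality between the semidefinite restriction `(SDP^{m,≤}_n)`
and its dual `(D-SDP^{m,≤}_n)`: the supremum of `F_n` over primal feasible pairs `(Q, F)`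
equals the infimum of `y` over dual feasible triples `(A, μ, y)`. -/
theorem strong_duality_restriction (m n : ℕ) (hn : 1 ≤ n) (hmn : n ≤ m) :
    sSup {v : ℝ | ∃ (Q : Matrix (Fin (m + 1)) (Fin (m + 1)) ℝ) (F : ℕ → ℝ),
      Q.PosSemidef ∧
      (∑ k ∈ Finset.range (m + 1), F k) = 1 ∧
      (∀ k ≤ m, 0 ≤ F k) ∧
      (∀ l, 1 ≤ l → l ≤ m →
        (∑ i : Fin (m + 1), ∑ j : Fin (m + 1),
          if i.val + j.val = 2 * l - 1 then Q i j else 0) = 0) ∧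
      (∀ l ≤ m,
        (∑ i : Fin (m + 1), ∑ j : Fin (m + 1),
          if i.val + j.val = 2 * l then Q i j else 0)
        = ∑ k ∈ Finset.Icc l m,
            ((-1 : ℝ) ^ (k + l) / (l.factorial : ℝ)) * (k.choose l : ℝ) * F k) ∧
      v = F n} =
    sInf {y : ℝ | ∃ (A : Matrix (Fin (m + 1)) (Fin (m + 1)) ℝ) (μ : ℕ → ℝ),
      A.PosSemidef ∧
      1 + μ n ≤ y ∧
      (∀ k ≤ m, μ k ≤ y) ∧
      (∀ (i j : Fin (m + 1)) (l : ℕ), i.val + j.val = 2 * l →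
        A i j = ∑ k ∈ Finset.range (l + 1),
          μ k * (l.choose k : ℝ) * (l.factorial : ℝ))} := by
  have hfeas : ∀ (Q : Matrix (Fin (m + 1)) (Fin (m + 1)) ℝ) (F : ℕ → ℝ),
      (∀ s < 2 * m + 1, constraintDefect Q F s = 0) ↔ _ := constraintDefect_eq_zero_iff
  generalize hP : {v : ℝ | ∃ (Q : Matrix (Fin (m + 1)) (Fin (m + 1)) ℝ) (F : ℕ → ℝ), _} = P
  generalize hD : {y : ℝ | ∃ (A : Matrix (Fin (m + 1)) (Fin (m + 1)) ℝ) (μ : ℕ → ℝ), _} = D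
  have hweak : ∀ v ∈ P, ∀ y ∈ D, v ≤ y := by
    subst hP hD
    rintro v ⟨Q, F, hQ, hF1, hF0, hodd, heven, rfl⟩ y ⟨A, μ, hA, hy, hμ, hAμ⟩
    exact primal_value_le_dual_value hmn hQ hF1 hF0 ((hfeas Q F).2 ⟨hodd, heven⟩) hA hy hμ hAμ
  have hzero : (0 : ℝ) ∈ P := by
    subst hP
    have hd := (hfeas _ _).1 fun s _ => constraintDefect_single (m := m) s
    refine ⟨_, _, posSemidef_single_zero, ?_, fun k _ => ?_, hd.1, hd.2, ?_⟩
    · simp [Pi.single_apply]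
    · rcases eq_or_ne k 0 with rfl | hk <;> simp [*]
    · rw [Pi.single_eq_of_ne (by omega : n ≠ 0)]
  have hbdd : BddAbove P := by
    subst hP
    refine ⟨1, ?_⟩
    rintro v ⟨Q, F, -, hF1, hF0, -, -, rfl⟩
    rw [← hF1]
    exact Finset.single_le_sum (fun k hk => hF0 k (Nat.lt_succ_iff.1 (Finset.mem_range.1 hk)))
      (Finset.mem_range.2 (Nat.lt_succ_iff.2 hmn))
  have hstrong : ∀ w, sSup P < w → w ∈ D := by
    intro w hw
    have hlt : ∀ v ∈ P, v < w := fun v hv => (le_csSup hbdd hv).trans_lt hw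
    have hw0 := hlt 0 hzero
    subst hP hD
    refine exists_dual_feasible hn hmn hw0 fun Q F hQ hF1 hF0 hd => (hlt _ ?_).ne
    exact ⟨Q, F, hQ, hF1, hF0, ((hfeas Q F).1 hd).1, ((hfeas Q F).1 hd).2, rfl⟩
  refine le_antisymm ?_ ?_
  · exact csSup_le ⟨0, hzero⟩ fun v hv =>
      le_csInf ⟨_, hstrong _ (lt_add_one _)⟩ fun y hy => hweak v hv y hy
  · refine le_of_forall_gt_imp_ge_of_dense fun w hw => ?_
    exact csInf_le ⟨0, fun y hy => hweak 0 hzero y hy⟩ (hstrong w hw)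
end

section
/- For every integer n ≥ 1, the sequence (ω_n^{m,≥})_{m ≥ n} of optimal values of the semidefinite relaxations (SDP^{m,≥}_n) is nonincreasing and converges, as m → ∞, to ω_n^{L²}, the optimal value of the infinite-dimensional linear program (LP^{L²}_n). -/
/-- `ω_n^{L²}`: the optimal value of the infinite-dimensional linear program `(LP^{L²}_n)`:
the supremum of `F_n` over sequences `F ≥ 0` with `∑ F = 1` whose Laguerre series is
nonnegative on `[0, ∞)`. -/
noncomputable def lpVal (n : ℕ) : ℝ :=
  sSup {v : ℝ | ∃ F : ℕ → ℝ, (∀ k, 0 ≤ F k) ∧ (∑' k, F k) = 1 ∧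
    (∀ x : ℝ, 0 ≤ x → 0 ≤ ∑' k, F k * laguerreFun k x) ∧ v = F n}

/-- `ω_n^{m,≥}`: the optimal value of the semidefinite relaxation `(SDP^{m,≥}_n)`. -/
noncomputable def sdpRelaxVal (n m : ℕ) : ℝ :=
  sSup {v : ℝ | ∃ (A : Matrix (Fin (m + 1)) (Fin (m + 1)) ℝ) (F : ℕ → ℝ),
    A.PosSemidef ∧
    (∑ k ∈ Finset.range (m + 1), F k) = 1 ∧
    (∀ k ≤ m, 0 ≤ F k) ∧
    (∀ (i j : Fin (m + 1)) (l : ℕ), i.val + j.val = 2 * l →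
      A i j = ∑ k ∈ Finset.range (l + 1), F k * (l.choose k : ℝ) * (l.factorial : ℝ)) ∧
    (∀ i j : Fin (m + 1), (i.val + j.val) % 2 = 1 → A i j = 0) ∧
    v = F n}

/-- Rescaled Charlier polynomials: orthogonal for the Poisson weight `a ^ m / m !`. -/
noncomputable def charlier (a : ℝ) (n m : ℕ) : ℝ :=
  ∑ k ∈ Finset.range (n + 1), (n.choose k : ℝ) * (m.descFactorial k : ℝ) * (-a) ^ (n - k)

theorem charlier_zero (a : ℝ) (m : ℕ) : charlier a 0 m = 1 := by
  simp [charlier]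

theorem charlier_succ_zero (a : ℝ) (n : ℕ) :
    charlier a (n + 1) 0 = -a * charlier a n 0 := by
  have h (n : ℕ) : charlier a n 0 = (-a) ^ n := by
    rw [charlier, Finset.sum_range_succ']
    simp
  rw [h, h, pow_succ']

theorem charlier_succ_succ (a : ℝ) (n m : ℕ) :
    charlier a (n + 1) (m + 1) = (m + 1) * charlier a n m - a * charlier a n (m + 1) := by
  have h1 : ∑ k ∈ Finset.range (n + 1), (n.choose k : ℝ) * ((m + 1).descFactorial (k + 1) : ℝ)
      * (-a) ^ (n - k) = (m + 1) * charlier a n m := by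
    rw [charlier, Finset.mul_sum]
    refine Finset.sum_congr rfl fun k _ => ?_
    rw [Nat.succ_descFactorial_succ]
    push_cast
    ring
  have h2 : ∑ k ∈ Finset.range (n + 1 + 1), (n.choose k : ℝ) * ((m + 1).descFactorial k : ℝ)
      * (-a) ^ (n + 1 - k) = -a * charlier a n (m + 1) := by
    rw [Finset.sum_range_succ, charlier, Finset.mul_sum]
    simp only [Nat.choose_succ_self, Nat.cast_zero, zero_mul, add_zero]
    refine Finset.sum_congr rfl fun k hk => ?_
    rw [Nat.succ_sub (by simpa [Nat.lt_succ_iff] using hk), pow_succ]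
    ring
  rw [sub_eq_add_neg, ← neg_mul, ← h1, ← h2, charlier, Finset.sum_range_succ',
    Finset.sum_range_succ' _ (n + 1), ← add_assoc, ← Finset.sum_add_distrib]
  congr 1
  · refine Finset.sum_congr rfl fun k _ => ?_
    rw [Nat.choose_succ_succ, Nat.add_sub_add_right]
    push_cast
    ring
  · simp

theorem charlier_succ_sub (a : ℝ) (n m : ℕ) :
    charlier a (n + 1) (m + 1) - charlier a (n + 1) m = (n + 1) * charlier a n m := by
  induction n generalizing m with
  | zero =>
    cases m with
    | zero => simp [charlier_succ_succ, charlier_succ_zero, charlier_zero]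
    | succ m => simp [charlier_succ_succ, charlier_zero]
  | succ n ih =>
    cases m with
    | zero =>
      rw [charlier_succ_succ, charlier_succ_zero a (n + 1)]
      have := ih 0
      push_cast at *
      linear_combination (-a) * this - (n + 1) * charlier_succ_zero a n
    | succ m =>
      rw [charlier_succ_succ a (n + 1), charlier_succ_succ a (n + 1) m]
      have h0 := ih m
      have h1 := ih (m + 1)
      have h2 := charlier_succ_succ a n m
      push_cast at *
      linear_combination (m + 1) * h0 - a * h1 - (n + 1) * h2

theorem abs_charlier_le {a : ℝ} (ha : 0 ≤ a) (n m : ℕ) : |charlier a n m| ≤ (m + a) ^ n := by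
  induction n generalizing m with
  | zero => simp [charlier_zero]
  | succ n ih =>
    cases m with
    | zero =>
      rw [charlier_succ_zero, abs_mul, abs_neg, abs_of_nonneg ha, pow_succ']
      simpa using mul_le_mul_of_nonneg_left (ih 0) ha
    | succ m =>
      rw [charlier_succ_succ, pow_succ']
      have h1 : |charlier a n m| ≤ ((m + 1 : ℕ) + a) ^ n :=
        (ih m).trans (by push_cast; gcongr; linarith)
      calc |(m + 1) * charlier a n m - a * charlier a n (m + 1)|
          ≤ |(m + 1) * charlier a n m| + |a * charlier a n (m + 1)| := abs_sub _ _
        _ = (m + 1) * |charlier a n m| + a * |charlier a n (m + 1)| := by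
            rw [abs_mul, abs_mul, abs_of_nonneg ha, abs_of_nonneg (by positivity : (0 : ℝ) ≤ m + 1)]
        _ ≤ (m + 1) * ((m + 1 : ℕ) + a) ^ n + a * ((m + 1 : ℕ) + a) ^ n := by
            gcongr
            exact ih (m + 1)
        _ = _ := by push_cast; ring

theorem summable_charlier_mul {a : ℝ} (ha : 0 ≤ a) (n n' : ℕ) :
    Summable fun m : ℕ => charlier a n m * charlier a n' m * (a ^ m / m.factorial) := by
  have hs := (Real.summable_pow_div_factorial (Real.exp 1 * a)).mul_left
    ((n + n').factorial * Real.exp a)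
  refine Summable.of_norm_bounded hs fun m => ?_
  have hma : (0 : ℝ) ≤ m + a := by positivity
  have h := Real.pow_div_factorial_le_exp (m + a) hma (n + n')
  rw [div_le_iff₀ (by positivity)] at h
  rw [norm_mul, norm_mul, Real.norm_eq_abs, Real.norm_eq_abs, Real.norm_of_nonneg (by positivity)]
  calc |charlier a n m| * |charlier a n' m| * (a ^ m / m.factorial)
      ≤ (m + a) ^ n * (m + a) ^ n' * (a ^ m / m.factorial) := by
        gcongr
        exacts [abs_charlier_le ha n m, abs_charlier_le ha n' m]
    _ ≤ (Real.exp (m + a) * (n + n').factorial) * (a ^ m / m.factorial) := by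
        rw [← pow_add]; gcongr
    _ = _ := by
        rw [Real.exp_add, mul_pow, ← Real.exp_nat_mul, mul_one]; ring

theorem tsum_charlier_sq {a : ℝ} (ha : 0 ≤ a) (n : ℕ) :
    ∑' m : ℕ, charlier a n m * charlier a n m * (a ^ m / m.factorial) =
      n.factorial * a ^ n * Real.exp a := by
  induction n with
  | zero =>
    simp only [charlier_zero, one_mul, Nat.factorial_zero, Nat.cast_one, pow_zero]
    rw [Real.exp_eq_exp_ℝ, NormedSpace.exp_eq_tsum_div]
  | succ n ih =>
    set w : ℕ → ℝ := fun m => a ^ m / m.factorial with hw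
    have hw1 (m : ℕ) : (m + 1) * w (m + 1) = a * w m := by
      simp only [hw, Nat.factorial_succ]
      push_cast
      field_simp
      ring
    have hs1 := summable_charlier_mul ha (n + 1) (n + 1)
    have hs2 := summable_charlier_mul ha (n + 1) n
    have hs3 := summable_charlier_mul ha n n
    have hs2' := (summable_nat_add_iff 1).2 hs2
    have e2 := hs2.tsum_eq_zero_add
    rw [hs1.tsum_eq_zero_add]
    have key (m : ℕ) :
        charlier a (n + 1) (m + 1) * charlier a (n + 1) (m + 1) * w (m + 1) =
        a * (n + 1) * (charlier a n m * charlier a n m * w m)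
        + a * (charlier a (n + 1) m * charlier a n m * w m)
        - a * (charlier a (n + 1) (m + 1) * charlier a n (m + 1) * w (m + 1)) := by
      have h1 := charlier_succ_succ a n m
      have h2 := charlier_succ_sub a n m
      linear_combination charlier a (n + 1) (m + 1) * w (m + 1) * h1 +
        charlier a (n + 1) (m + 1) * charlier a n m * hw1 m + a * charlier a n m * w m * h2
    rw [tsum_congr key, Summable.tsum_sub ((hs3.mul_left _).add (hs2.mul_left _)) (hs2'.mul_left _),
      Summable.tsum_add (hs3.mul_left _) (hs2.mul_left _), tsum_mul_left, tsum_mul_left,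
      tsum_mul_left, ih, e2, charlier_succ_zero, Nat.factorial_succ]
    push_cast
    ring

theorem charlier_self (a : ℝ) (n : ℕ) : charlier a n n = n.factorial * laguerreL n a := by
  rw [charlier, ← Finset.sum_range_reflect, laguerreL, Finset.mul_sum]
  refine Finset.sum_congr rfl fun l hl => ?_
  have hl' : l ≤ n := by simpa [Nat.lt_succ_iff] using hl
  have h1 : n + 1 - 1 - l = n - l := by omega
  have h2 : n - (n - l) = l := by omega
  have h3 := Nat.factorial_mul_descFactorial (Nat.sub_le n l)
  rw [h2] at h3
  rw [h1, h2, Nat.choose_symm hl', neg_pow, ← h3]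
  push_cast
  field_simp

theorem abs_laguerreFun_le_one (k : ℕ) {x : ℝ} (hx : 0 ≤ x) : |laguerreFun k x| ≤ 1 := by
  have hsq : laguerreL k x ^ 2 ≤ Real.exp x := by
    rcases hx.eq_or_lt with rfl | hx'
    · have : laguerreL k 0 = 1 := by
        rw [laguerreL, Finset.sum_range_succ']
        simp
      simp [this]
    have h := (summable_charlier_mul hx k k).le_tsum k fun m _ =>
      mul_nonneg (mul_self_nonneg _) (by positivity)
    rw [tsum_charlier_sq hx, charlier_self] at h
    have hpos : 0 < (k.factorial : ℝ) * x ^ k := by positivity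
    refine le_of_mul_le_mul_left (le_trans (le_of_eq ?_) h) hpos
    field_simp
  rw [← sq_le_one_iff_abs_le_one, laguerreFun, mul_pow, mul_pow, ← pow_mul, mul_comm k 2, pow_mul,
    neg_one_sq, one_pow, one_mul, ← Real.exp_nat_mul]
  calc laguerreL k x ^ 2 * Real.exp ((2 : ℕ) * (-x / 2))
      ≤ Real.exp x * Real.exp ((2 : ℕ) * (-x / 2)) := by gcongr
    _ = 1 := by rw [← Real.exp_add, ← Real.exp_zero]; congr 1; push_cast; ring

theorem continuous_laguerreFun (k : ℕ) : Continuous (laguerreFun k) := by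
  unfold laguerreFun laguerreL
  fun_prop

theorem sum_neg_one_pow_mul_choose (k l : ℕ) :
    ∑ j ∈ Finset.range (k + 1), (-1 : ℝ) ^ (k - j) * k.choose j * (l + j).choose l =
      (l.choose k : ℝ) := by
  have h := fwdDiff_iter_eq_sum_shift (1 : ℕ) (fun x ↦ x.choose l : ℕ → ℤ) k l
  have hv : (fwdDiff (1 : ℕ))^[k] (fun x ↦ x.choose l : ℕ → ℤ) l = l.choose k := by
    rcases le_or_gt k l with hkl | hkl
    · obtain ⟨j, rfl⟩ := Nat.exists_eq_add_of_le hkl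
      rw [fwdDiff_iter_choose, Nat.choose_symm_add]
    · obtain ⟨j, rfl⟩ := Nat.exists_eq_add_of_lt hkl
      have e : l + j + 1 = j + 1 + l := by ring
      have h0 := fwdDiff_iter_choose 0 l
      simp only [add_zero, Nat.choose_zero_right, Nat.cast_one] at h0
      rw [Nat.choose_eq_zero_of_lt hkl, e, Function.iterate_add_apply, h0,
        Function.iterate_add_apply, Function.iterate_one, fwdDiff_const]
      simp [fwdDiff_iter_eq_sum_shift]
  rw [hv] at h
  have h' := congrArg (Int.cast : ℤ → ℝ) h
  push_cast at h'
  rw [h']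
  refine Finset.sum_congr rfl fun j _ => ?_
  simp

theorem integral_pow_mul_exp_neg_Ioi (n : ℕ) :
    ∫ x in Set.Ioi (0 : ℝ), x ^ n * Real.exp (-x) = n.factorial := by
  rw [← Real.Gamma_nat_eq_factorial, Real.Gamma_eq_integral (by positivity)]
  refine MeasureTheory.setIntegral_congr_fun measurableSet_Ioi fun x _ => ?_
  simp [mul_comm]

open MeasureTheory Filter Asymptotics Topology Polynomial Set

/-- Continuous functions growing more slowly than every increasing exponential at `+∞`. -/
def Subexponential (g : ℝ → ℝ) : Prop :=
  Continuous g ∧ ∀ ε > 0, g =O[atTop] fun x => Real.exp (ε * x)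

namespace Subexponential

theorem const (c : ℝ) : Subexponential fun _ => c := by
  refine ⟨continuous_const, fun ε hε => ?_⟩
  refine (isBigO_const_const c (one_ne_zero (α := ℝ)) atTop).trans ?_
  refine IsBigO.of_bound 1 ?_
  filter_upwards [eventually_ge_atTop 0] with x hx
  simpa using mul_nonneg hε.le hx

theorem id : Subexponential fun x => x := by
  refine ⟨continuous_id, fun ε hε => ?_⟩
  simpa using (isLittleO_pow_exp_pos_mul_atTop 1 hε).isBigO

theorem add {g h : ℝ → ℝ} (hg : Subexponential g) (hh : Subexponential h) :
    Subexponential fun x => g x + h x :=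
  ⟨hg.1.add hh.1, fun ε hε => (hg.2 ε hε).add (hh.2 ε hε)⟩

theorem mul {g h : ℝ → ℝ} (hg : Subexponential g) (hh : Subexponential h) :
    Subexponential fun x => g x * h x := by
  refine ⟨hg.1.mul hh.1, fun ε hε => ?_⟩
  refine ((hg.2 (ε / 2) (by positivity)).mul (hh.2 (ε / 2) (by positivity))).congr_right
    fun x => ?_
  rw [← Real.exp_add]
  congr 1
  ring

theorem pow {g : ℝ → ℝ} (hg : Subexponential g) (n : ℕ) : Subexponential fun x => g x ^ n := by
  induction n with
  | zero => simpa using const 1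
  | succ n ih => simpa only [pow_succ] using ih.mul hg

theorem sum {ι : Type*} (s : Finset ι) {g : ι → ℝ → ℝ} (hg : ∀ i, Subexponential (g i)) :
    Subexponential fun x => ∑ i ∈ s, g i x := by
  classical
  induction s using Finset.induction_on with
  | empty => simpa using const 0
  | insert i s hi ih => simpa only [Finset.sum_insert hi] using (hg i).add ih

theorem polynomial (p : ℝ[X]) : Subexponential fun x => p.eval x := by
  simp only [Polynomial.eval_eq_sum_range]
  exact sum _ fun i => (const _).mul (id.pow i)

theorem exp_neg {c : ℝ} (hc : 0 ≤ c) : Subexponential fun x => Real.exp (-c * x) := by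
  refine ⟨by fun_prop, fun ε hε => IsBigO.of_bound 1 ?_⟩
  filter_upwards [eventually_ge_atTop 0] with x hx
  rw [Real.norm_of_nonneg (Real.exp_pos _).le, Real.norm_of_nonneg (Real.exp_pos _).le, one_mul,
    Real.exp_le_exp]
  nlinarith [mul_nonneg hc hx, mul_nonneg hε.le hx]

theorem integrableOn_mul_exp {g : ℝ → ℝ} (hg : Subexponential g) {b : ℝ} (hb : 0 < b) :
    IntegrableOn (fun x => g x * Real.exp (-b * x)) (Ioi 0) := by
  refine integrable_of_isBigO_exp_neg (b := b / 2) (by positivity)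
    (hg.1.mul (by fun_prop)).continuousOn ?_
  refine ((hg.2 (b / 2) (by positivity)).mul
    (isBigO_refl (fun x => Real.exp (-b * x)) atTop)).congr_right fun x => ?_
  rw [← Real.exp_add]
  congr 1
  ring

end Subexponential

/-- Truncations of the power series of `exp (-x / 8)`. -/
noncomputable def expNegTrunc (N : ℕ) : ℝ[X] :=
  ∑ k ∈ Finset.range N, C ((-1 / 8 : ℝ) ^ k / k.factorial) * X ^ k

theorem eval_expNegTrunc (N : ℕ) (x : ℝ) :
    (expNegTrunc N).eval x = ∑ k ∈ Finset.range N, (-x / 8) ^ k / k.factorial := by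
  rw [expNegTrunc, Polynomial.eval_finsetSum]
  refine Finset.sum_congr rfl fun k _ => ?_
  simp only [Polynomial.eval_mul, Polynomial.eval_C, Polynomial.eval_pow, Polynomial.eval_X]
  rw [show -x / 8 = (-1 / 8) * x by ring, mul_pow]
  ring

theorem abs_eval_expNegTrunc_le (N : ℕ) {x : ℝ} (hx : 0 ≤ x) :
    |(expNegTrunc N).eval x| ≤ Real.exp (x / 8) := by
  rw [eval_expNegTrunc]
  refine (Finset.abs_sum_le_sum_abs _ _).trans
    (le_trans (le_of_eq ?_) (Real.sum_le_exp_of_nonneg (by positivity : 0 ≤ x / 8) N))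
  refine Finset.sum_congr rfl fun k _ => ?_
  rw [abs_div, abs_pow, neg_div, abs_neg, abs_of_nonneg (by positivity : 0 ≤ x / 8), Nat.abs_cast]

theorem tendsto_eval_expNegTrunc (x : ℝ) :
    Tendsto (fun N => (expNegTrunc N).eval x) atTop (𝓝 (Real.exp (-x / 8))) := by
  simp only [eval_expNegTrunc]
  have h := NormedSpace.expSeries_div_hasSum_exp (-x / 8)
  rw [← Real.exp_eq_exp_ℝ] at h
  exact h.tendsto_sum_nat

section Positivity

variable {f : ℝ → ℝ} {K : ℝ}

theorem integrableOn_mul_weight (hf : ContinuousOn f (Ici 0)) (hK : ∀ x, 0 ≤ x → |f x| ≤ K)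
    {g : ℝ → ℝ} (hg : Subexponential g) :
    IntegrableOn (fun x => g x * (f x * Real.exp (-x / 2))) (Ioi 0) := by
  have h := (hg.integrableOn_mul_exp (b := 1 / 2) (by norm_num)).bdd_mul (c := K)
    ((hf.mono Ioi_subset_Ici_self).aestronglyMeasurable measurableSet_Ioi)
    ((ae_restrict_iff' measurableSet_Ioi).2 (Eventually.of_forall fun x hx => hK x (le_of_lt hx)))
  refine h.congr (Eventually.of_forall fun x => ?_)
  simp only
  rw [show -x / 2 = -(1 / 2) * x by ring]
  ring

/-- A limiting argument for weighted integrals of squares. -/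
theorem integral_sq_mul_nonneg_of_tendsto (hf : ContinuousOn f (Ici 0))
    (hK : ∀ x, 0 ≤ x → |f x| ≤ K) {g : ℝ → ℝ} {G : ℕ → ℝ → ℝ} {B : ℝ → ℝ}
    (hG : ∀ N, Continuous (G N)) (hB : IntegrableOn (fun x => B x * Real.exp (-x / 2)) (Ioi 0))
    (hGB : ∀ N, ∀ x, 0 < x → G N x ^ 2 ≤ B x)
    (hlim : ∀ x, 0 < x → Tendsto (fun N => G N x) atTop (𝓝 (g x)))
    (hpos : ∀ N, 0 ≤ ∫ x in Ioi 0, G N x ^ 2 * (f x * Real.exp (-x / 2))) :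
    0 ≤ ∫ x in Ioi 0, g x ^ 2 * (f x * Real.exp (-x / 2)) := by
  refine ge_of_tendsto' (tendsto_integral_of_dominated_convergence
    (F := fun N x => G N x ^ 2 * (f x * Real.exp (-x / 2)))
    (fun x => K * (B x * Real.exp (-x / 2))) (fun N => ?_) (hB.const_mul K) (fun N => ?_) ?_) hpos
  · refine ContinuousOn.aestronglyMeasurable ?_ measurableSet_Ioi
    refine ((hG N).pow 2).continuousOn.mul ((hf.mono Ioi_subset_Ici_self).mul ?_)
    exact Continuous.continuousOn (by fun_prop)
  · refine (ae_restrict_iff' measurableSet_Ioi).2 (Eventually.of_forall fun x hx => ?_)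
    have hx' : 0 < x := hx
    have h1 := hK x hx'.le
    have h2 := hGB N x hx'
    rw [norm_mul, norm_mul, Real.norm_of_nonneg (sq_nonneg _), Real.norm_eq_abs,
      Real.norm_of_nonneg (Real.exp_pos _).le]
    calc G N x ^ 2 * (|f x| * Real.exp (-x / 2)) ≤ B x * (K * Real.exp (-x / 2)) := by
          gcongr
          exact (sq_nonneg _).trans h2
      _ = _ := by ring
  · refine (ae_restrict_iff' measurableSet_Ioi).2 (Eventually.of_forall fun x hx => ?_)
    exact ((hlim x hx).pow 2).mul_const _

theorem integral_sq_expPoly_nonneg (hf : ContinuousOn f (Ici 0)) (hK : ∀ x, 0 ≤ x → |f x| ≤ K)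
    (hpos : ∀ p : ℝ[X], 0 ≤ ∫ x in Ioi 0, p.eval x ^ 2 * (f x * Real.exp (-x / 2)))
    (J : ℕ) (p : ℕ → ℝ[X]) :
    0 ≤ ∫ x in Ioi 0, (∑ j ∈ Finset.range (J + 1), (p j).eval x * Real.exp (-x / 8) ^ j) ^ 2 *
      (f x * Real.exp (-x / 2)) := by
  induction J generalizing p with
  | zero => simpa using hpos (p 0)
  | succ J ih =>
    have hu : Subexponential fun x => Real.exp (-x / 8) := by
      convert! Subexponential.exp_neg (c := 1 / 8) (by norm_num) using 3
      ring
    set a : ℝ → ℝ := fun x => ∑ j ∈ Finset.range (J + 1), (p j).eval x * Real.exp (-x / 8) ^ j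
      with ha
    set b : ℝ → ℝ := fun x => (p (J + 1)).eval x * Real.exp (-x / 8) ^ J with hb
    have hsa : Subexponential a :=
      Subexponential.sum _ fun j => (Subexponential.polynomial _).mul (hu.pow j)
    have hsb : Subexponential b := (Subexponential.polynomial _).mul (hu.pow J)
    refine integral_sq_mul_nonneg_of_tendsto hf hK
      (G := fun N x => a x + b x * (expNegTrunc N).eval x)
      (B := fun x => 2 * a x ^ 2 + 2 * b x ^ 2 * Real.exp (x / 4)) (fun N => ?_) ?_ ?_ ?_ ?_
    · exact hsa.1.add (hsb.1.mul (Polynomial.continuous _))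
    · have h1 := ((Subexponential.const 2).mul (hsa.pow 2)).integrableOn_mul_exp
        (b := 1 / 2) (by norm_num)
      have h2 := ((Subexponential.const 2).mul (hsb.pow 2)).integrableOn_mul_exp
        (b := 1 / 4) (by norm_num)
      refine (h1.add h2).congr (Eventually.of_forall fun x => ?_)
      simp only [Pi.add_apply]
      rw [add_mul, mul_assoc (2 * b x ^ 2), ← Real.exp_add]
      congr 3 <;> ring_nf
    · intro N x hx
      have h1 := abs_eval_expNegTrunc_le N hx.le
      have h2 : (expNegTrunc N).eval x ^ 2 ≤ Real.exp (x / 4) := by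
        rw [← sq_abs]
        refine (pow_le_pow_left₀ (abs_nonneg _) h1 2).trans (le_of_eq ?_)
        rw [← Real.exp_nat_mul]
        congr 1
        push_cast
        ring
      have h3 := mul_le_mul_of_nonneg_left h2 (sq_nonneg (b x))
      nlinarith [sq_nonneg (a x - b x * (expNegTrunc N).eval x)]
    · intro x _
      have h := ((tendsto_eval_expNegTrunc x).const_mul (b x)).const_add (a x)
      convert! h using 2
      rw [Finset.sum_range_succ, pow_succ, ← mul_assoc]
    · intro N
      have h := ih (Function.update p J (p J + p (J + 1) * expNegTrunc N))
      convert! h using 4 with x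
      simp only [ha, hb, Finset.sum_range_succ]
      have hupd : ∀ j ∈ Finset.range J,
          (Function.update p J (p J + p (J + 1) * expNegTrunc N) j).eval x *
            Real.exp (-x / 8) ^ j = (p j).eval x * Real.exp (-x / 8) ^ j := fun j hj => by
        rw [Function.update_of_ne (Finset.mem_range.1 hj).ne]
      rw [Finset.sum_congr rfl hupd]
      simp only [Function.update_self, Polynomial.eval_add, Polynomial.eval_mul]
      ring

theorem integral_sq_comp_exp_nonneg (hf : ContinuousOn f (Ici 0)) (hK : ∀ x, 0 ≤ x → |f x| ≤ K)
    (hpos : ∀ p : ℝ[X], 0 ≤ ∫ x in Ioi 0, p.eval x ^ 2 * (f x * Real.exp (-x / 2)))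
    {φ : ℝ → ℝ} (hφ : Continuous φ) :
    0 ≤ ∫ x in Ioi 0, φ (Real.exp (-x / 8)) ^ 2 * (f x * Real.exp (-x / 2)) := by
  choose q hq using fun N : ℕ => exists_polynomial_near_of_continuousOn 0 1 φ hφ.continuousOn
    (1 / ((N : ℝ) + 1)) (by positivity)
  obtain ⟨M, hM⟩ := isCompact_Icc.exists_bound_of_continuousOn (s := Icc (0 : ℝ) 1) hφ.continuousOn
  have hu {x : ℝ} (hx : 0 < x) : Real.exp (-x / 8) ∈ Icc (0 : ℝ) 1 :=
    ⟨(Real.exp_pos _).le, Real.exp_le_one_iff.2 (by linarith)⟩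
  refine integral_sq_mul_nonneg_of_tendsto hf hK
    (G := fun N x => (q N).eval (Real.exp (-x / 8))) (B := fun _ => (M + 1) ^ 2)
    (fun N => ?_) ?_ ?_ ?_ ?_
  · exact (q N).continuous.comp (by fun_prop)
  · convert! (Subexponential.const ((M + 1) ^ 2)).integrableOn_mul_exp
      (b := 1 / 2) (by norm_num) using 4
    ring
  · intro N x hx
    have h1 := (hq N _ (hu hx)).le
    have h2 := hM _ (hu hx)
    have h3 : 1 / ((N : ℝ) + 1) ≤ 1 := by
      rw [div_le_one (by positivity)]
      linarith [N.cast_nonneg (α := ℝ)]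
    rw [Real.norm_eq_abs, abs_le] at h2
    rw [abs_le] at h1
    exact sq_le_sq' (by linarith) (by linarith)
  · intro x hx
    rw [tendsto_iff_dist_tendsto_zero]
    exact squeeze_zero (fun _ => dist_nonneg) (fun N => (hq N _ (hu hx)).le)
      tendsto_one_div_add_atTop_nhds_zero_nat
  · intro N
    have h := integral_sq_expPoly_nonneg hf hK hpos (q N).natDegree fun j => C ((q N).coeff j)
    simpa only [Polynomial.eval_C, ← Polynomial.eval_eq_sum_range] using h

/-- A bounded continuous function on `[0, ∞)` whose integrals against squares of polynomials,
with exponential weight, are nonnegative is itself nonnegative. -/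
theorem nonneg_of_integral_sq_nonneg (hf : ContinuousOn f (Ici 0)) (hK : ∀ x, 0 ≤ x → |f x| ≤ K)
    (hpos : ∀ p : ℝ[X], 0 ≤ ∫ x in Ioi 0, p.eval x ^ 2 * (f x * Real.exp (-x / 2)))
    {x : ℝ} (hx : 0 ≤ x) : 0 ≤ f x := by
  by_contra! hneg
  have hev : ∀ᶠ y in 𝓝[≥] x, f y < 0 :=
    ((hf x hx).mono (Ici_subset_Ici.2 hx)).eventually_lt_const hneg
  obtain ⟨b, hxb, hb⟩ := (mem_nhdsGE_iff_exists_Ico_subset).1 hev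
  have hxb' : x < b := hxb
  set φ : ℝ → ℝ := fun u => max 0 ((u - Real.exp (-b / 8)) * (Real.exp (-x / 8) - u))
  have hφc : Continuous φ := by fun_prop
  have h := integral_sq_comp_exp_nonneg hf hK hpos hφc
  have hzero {y : ℝ} (hy : y ∉ Ioo x b) : φ (Real.exp (-y / 8)) = 0 := by
    refine max_eq_left ?_
    rcases le_or_gt y x with h1 | h1
    · have e1 : Real.exp (-x / 8) ≤ Real.exp (-y / 8) := Real.exp_le_exp.2 (by linarith)
      have e2 : Real.exp (-b / 8) ≤ Real.exp (-x / 8) := Real.exp_le_exp.2 (by linarith)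
      exact mul_nonpos_of_nonneg_of_nonpos (by linarith) (by linarith)
    · have h2 : b ≤ y := by
        by_contra! h2
        exact hy ⟨h1, h2⟩
      have e1 : Real.exp (-y / 8) ≤ Real.exp (-x / 8) := Real.exp_le_exp.2 (by linarith)
      have e2 : Real.exp (-y / 8) ≤ Real.exp (-b / 8) := Real.exp_le_exp.2 (by linarith)
      exact mul_nonpos_of_nonpos_of_nonneg (by linarith) (by linarith)
  have hposφ {y : ℝ} (hy : y ∈ Ioo x b) : 0 < φ (Real.exp (-y / 8)) := by
    have e1 : Real.exp (-y / 8) < Real.exp (-x / 8) := Real.exp_lt_exp.2 (by linarith [hy.1])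
    have e2 : Real.exp (-b / 8) < Real.exp (-y / 8) := Real.exp_lt_exp.2 (by linarith [hy.2])
    exact lt_max_of_lt_right (mul_pos (by linarith) (by linarith))
  have hint : IntegrableOn
      (fun y => φ (Real.exp (-y / 8)) ^ 2 * (f y * Real.exp (-y / 2))) (Ioi 0) := by
    refine integrableOn_mul_weight hf hK (g := fun y => φ (Real.exp (-y / 8)) ^ 2)
      (Subexponential.pow ⟨by fun_prop, fun ε hε => ?_⟩ 2)
    refine (isBigO_zero (fun x : ℝ => Real.exp (ε * x)) atTop).congr' ?_ EventuallyEq.rfl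
    filter_upwards [eventually_ge_atTop b] with y hy
    exact (hzero fun h' => absurd h'.2 (not_lt.2 hy)).symm
  have hlt : 0 < ∫ y in Ioi 0, -(φ (Real.exp (-y / 8)) ^ 2 * (f y * Real.exp (-y / 2))) := by
    refine (setIntegral_pos_iff_support_of_nonneg_ae ?_ hint.neg).2 ?_
    rotate_left
    · refine lt_of_lt_of_le (b := volume (Ioo x b)) (by simpa using hxb') (measure_mono ?_)
      intro y hy
      refine ⟨?_, lt_of_le_of_lt hx hy.1⟩
      have hfy : f y < 0 := hb ⟨hy.1.le, hy.2⟩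
      simp only [Function.mem_support, Pi.neg_apply]
      exact neg_ne_zero.2 (mul_ne_zero (pow_ne_zero 2 (hposφ hy).ne')
        (mul_ne_zero (ne_of_lt hfy) (Real.exp_pos _).ne'))
    · refine Eventually.of_forall fun y => ?_
      simp only [Pi.zero_apply, Pi.neg_apply, Left.nonneg_neg_iff]
      by_cases hy : y ∈ Ioo x b
      · have hfy : f y < 0 := hb ⟨hy.1.le, hy.2⟩
        exact mul_nonpos_of_nonneg_of_nonpos (sq_nonneg _)
          (mul_nonpos_of_nonpos_of_nonneg hfy.le (Real.exp_pos _).le)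
      · simp [hzero hy]
  rw [integral_neg] at hlt
  linarith

end Positivity

/-- The `l`-th moment of `∑ F_k 𝓛_k` with respect to `e^{-x/2} dx`. -/
noncomputable def laguerreMoment (F : ℕ → ℝ) (l : ℕ) : ℝ :=
  ∑ k ∈ Finset.range (l + 1), F k * (l.choose k : ℝ) * (l.factorial : ℝ)

/-- The symmetrized moment matrix of order `m`. -/
noncomputable def momentMatrix (m : ℕ) (F : ℕ → ℝ) : Matrix (Fin (m + 1)) (Fin (m + 1)) ℝ :=
  Matrix.of fun i j => if (i.val + j.val) % 2 = 1 then 0 else laguerreMoment F ((i.val + j.val) / 2)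

/-- The Laguerre series `∑ F_k 𝓛_k`. -/
noncomputable def laguerreSeries (F : ℕ → ℝ) (x : ℝ) : ℝ := ∑' k, F k * laguerreFun k x

theorem integral_pow_mul_laguerreFun (k l : ℕ) :
    ∫ x in Ioi (0 : ℝ), x ^ l * (laguerreFun k x * Real.exp (-x / 2)) =
      (l.choose k : ℝ) * l.factorial := by
  have hpt (x : ℝ) : x ^ l * (laguerreFun k x * Real.exp (-x / 2)) =
      ∑ j ∈ Finset.range (k + 1), ((-1 : ℝ) ^ k * ((-1) ^ j / j.factorial * k.choose j)) *
        (x ^ (l + j) * Real.exp (-x)) := by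
    have he : Real.exp (-x) = Real.exp (-x / 2) * Real.exp (-x / 2) := by
      rw [← Real.exp_add]
      congr 1
      ring
    rw [laguerreFun, laguerreL, he, Finset.mul_sum, Finset.sum_mul, Finset.sum_mul, Finset.mul_sum]
    refine Finset.sum_congr rfl fun j _ => ?_
    rw [pow_add]
    ring
  simp only [hpt]
  rw [integral_finsetSum]
  · simp only [integral_const_mul, integral_pow_mul_exp_neg_Ioi]
    rw [← sum_neg_one_pow_mul_choose k l, Finset.sum_mul]
    refine Finset.sum_congr rfl fun j hj => ?_
    have hj' : j ≤ k := by simpa [Nat.lt_succ_iff] using hj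
    obtain ⟨i, rfl⟩ := Nat.exists_eq_add_of_le hj'
    rw [← Nat.add_choose_mul_factorial_mul_factorial l j, Nat.add_sub_cancel_left]
    have h1 : ((-1 : ℝ) ^ j) * (-1) ^ j = 1 := by rw [← mul_pow]; simp
    push_cast
    rw [pow_add]
    have hf : (j.factorial : ℝ) ≠ 0 := by positivity
    field_simp
    rw [@Nat.choose_symm_add l j]
    linear_combination ((j + i).choose j * (l + j).choose j : ℝ) * h1
  · intro j _
    have h := ((Subexponential.id.pow (l + j)).integrableOn_mul_exp one_pos).const_mul
      ((-1 : ℝ) ^ k * ((-1) ^ j / j.factorial * k.choose j))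
    simpa only [neg_mul, one_mul] using h

section Series

variable {F : ℕ → ℝ}

theorem norm_mul_laguerreFun_le (hF : ∀ k, 0 ≤ F k) (k : ℕ) {x : ℝ} (hx : 0 ≤ x) :
    ‖F k * laguerreFun k x‖ ≤ F k := by
  rw [norm_mul, Real.norm_of_nonneg (hF k)]
  exact mul_le_of_le_one_right (hF k) (abs_laguerreFun_le_one k hx)

theorem continuousOn_laguerreSeries (hF : ∀ k, 0 ≤ F k) (hs : Summable F) :
    ContinuousOn (laguerreSeries F) (Ici 0) :=
  continuousOn_tsum (fun k => (continuous_const.mul (continuous_laguerreFun k)).continuousOn) hs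
    fun k _ hx => norm_mul_laguerreFun_le hF k hx

theorem abs_laguerreSeries_le (hF : ∀ k, 0 ≤ F k) (hs : Summable F) (x : ℝ) (hx : 0 ≤ x) :
    |laguerreSeries F x| ≤ ∑' k, F k :=
  tsum_of_norm_bounded hs.hasSum fun k => norm_mul_laguerreFun_le hF k hx

theorem integrableOn_mul_laguerreSeries (hF : ∀ k, 0 ≤ F k) (hs : Summable F)
    {g : ℝ → ℝ} (hg : Subexponential g) :
    IntegrableOn (fun x => g x * (laguerreSeries F x * Real.exp (-x / 2))) (Ioi 0) :=
  integrableOn_mul_weight (continuousOn_laguerreSeries hF hs) (abs_laguerreSeries_le hF hs) hg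

theorem integral_pow_mul_laguerreSeries (hF : ∀ k, 0 ≤ F k) (hs : Summable F) (l : ℕ) :
    ∫ x in Ioi (0 : ℝ), x ^ l * (laguerreSeries F x * Real.exp (-x / 2)) = laguerreMoment F l := by
  have hw : IntegrableOn (fun x : ℝ => x ^ l * Real.exp (-x / 2)) (Ioi 0) := by
    convert! (Subexponential.id.pow l).integrableOn_mul_exp (b := 1 / 2) (by norm_num) using 4
    ring
  have hterm (k : ℕ) : IntegrableOn
      (fun x : ℝ => F k * (x ^ l * (laguerreFun k x * Real.exp (-x / 2)))) (Ioi 0) :=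
    (integrableOn_mul_weight (continuous_laguerreFun k).continuousOn
      (fun x hx => abs_laguerreFun_le_one k hx) (Subexponential.id.pow l)).const_mul (F k)
  have hnorm (k : ℕ) : ∫ x in Ioi (0 : ℝ),
      ‖F k * (x ^ l * (laguerreFun k x * Real.exp (-x / 2)))‖ ≤
      F k * ∫ x in Ioi (0 : ℝ), x ^ l * Real.exp (-x / 2) := by
    rw [← integral_const_mul]
    refine setIntegral_mono_on (hterm k).norm (hw.const_mul _) measurableSet_Ioi fun x hx => ?_
    have hx' : 0 < x := hx
    have h1 := abs_laguerreFun_le_one k hx'.le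
    rw [norm_mul, norm_mul, norm_mul, Real.norm_of_nonneg (hF k),
      Real.norm_of_nonneg (pow_nonneg hx'.le l), Real.norm_of_nonneg (Real.exp_pos _).le,
      Real.norm_eq_abs]
    have := hF k
    gcongr
    exact mul_le_of_le_one_left (Real.exp_pos _).le h1
  have hsum := hasSum_integral_of_summable_integral_norm hterm
    (Summable.of_nonneg_of_le (fun k => integral_nonneg fun x => norm_nonneg _) hnorm
      (hs.mul_right _))
  simp only [integral_const_mul, integral_pow_mul_laguerreFun] at hsum
  have hfin : HasSum (fun k => F k * ((l.choose k : ℝ) * l.factorial)) (laguerreMoment F l) := by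
    simp only [laguerreMoment, mul_assoc]
    refine hasSum_sum_of_ne_finset_zero fun k hk => ?_
    rw [Nat.choose_eq_zero_of_lt (Nat.lt_of_succ_le (not_lt.1 fun h => hk (Finset.mem_range.2 h)))]
    simp
  rw [← hsum.unique hfin]
  refine setIntegral_congr_fun measurableSet_Ioi fun x hx => ?_
  simp only [laguerreSeries]
  rw [← tsum_mul_right, ← tsum_mul_left]
  refine tsum_congr fun k => ?_
  ring

theorem momentMatrix_isHermitian (m : ℕ) (F : ℕ → ℝ) : (momentMatrix m F).IsHermitian := by
  ext i j
  simp [momentMatrix, add_comm]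

/-- Truncated moment matrices of a nonnegative Laguerre series are positive semidefinite. -/
theorem momentMatrix_posSemidef (hF : ∀ k, 0 ≤ F k) (hs : Summable F)
    (hpos : ∀ x, 0 ≤ x → 0 ≤ laguerreSeries F x) (m : ℕ) : (momentMatrix m F).PosSemidef := by
  refine .of_dotProduct_mulVec_nonneg (momentMatrix_isHermitian m F) fun c => ?_
  set h : Fin (m + 1) → Fin (m + 1) → ℝ → ℝ := fun i j x =>
    if (i.val + j.val) % 2 = 1 then 0 else x ^ ((i.val + j.val) / 2) with hh
  have hsub (i j) : Subexponential (h i j) := by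
    by_cases hij : (i.val + j.val) % 2 = 1
    · simpa [hh, hij] using Subexponential.const 0
    · simpa [hh, hij] using Subexponential.id.pow _
  have hent (i j) : momentMatrix m F i j =
      ∫ x in Ioi (0 : ℝ), h i j x * (laguerreSeries F x * Real.exp (-x / 2)) := by
    by_cases hij : (i.val + j.val) % 2 = 1
    · simp [momentMatrix, hh, hij]
    · simp [momentMatrix, hh, hij, integral_pow_mul_laguerreSeries hF hs]
  have hquad : star c ⬝ᵥ (momentMatrix m F).mulVec c = ∫ x in Ioi (0 : ℝ),
      (∑ i, ∑ j, c i * c j * h i j x) * (laguerreSeries F x * Real.exp (-x / 2)) := by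
    have hint (i j) := (integrableOn_mul_laguerreSeries hF hs (hsub i j)).const_mul (c i * c j)
    simp only [Finset.sum_mul, mul_assoc (_ * _)]
    rw [integral_finsetSum _ fun i _ => integrable_finsetSum _ fun j _ => hint i j]
    simp only [dotProduct, Matrix.mulVec, Finset.mul_sum, star_trivial]
    refine Finset.sum_congr rfl fun i _ => ?_
    rw [integral_finsetSum _ fun j _ => hint i j]
    refine Finset.sum_congr rfl fun j _ => ?_
    rw [integral_const_mul, ← hent]
    ring
  rw [hquad]
  refine setIntegral_nonneg measurableSet_Ioi fun x hx => ?_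
  have hx' : 0 < x := hx
  refine mul_nonneg ?_ (mul_nonneg (hpos x hx'.le) (Real.exp_pos _).le)
  have hij (i j) : h i j x =
      (√x ^ i.val * √x ^ j.val + (-√x) ^ i.val * (-√x) ^ j.val) / 2 := by
    rw [← pow_add, ← pow_add]
    by_cases hij : (i.val + j.val) % 2 = 1
    · rw [(Nat.odd_iff.2 hij).neg_pow]
      simp [hh, hij]
    · have he : Even (i.val + j.val) := Nat.even_iff.2 (by omega)
      rw [he.neg_pow]
      obtain ⟨l, hl⟩ := he.two_dvd
      simp [hh, hl, pow_mul, Real.sq_sqrt hx'.le]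
  have hsq : ∑ i, ∑ j, c i * c j * h i j x =
      ((∑ i, c i * √x ^ i.val) ^ 2 + (∑ i, c i * (-√x) ^ i.val) ^ 2) / 2 := by
    rw [sq, sq, Finset.sum_mul_sum, Finset.sum_mul_sum, ← Finset.sum_add_distrib, Finset.sum_div]
    refine Finset.sum_congr rfl fun i _ => ?_
    rw [← Finset.sum_add_distrib, Finset.sum_div]
    refine Finset.sum_congr rfl fun j _ => ?_
    rw [hij]
    ring
  rw [hsq]
  positivity

/-- A Laguerre series all of whose moment matrices are positive semidefinite is nonnegative. -/
theorem laguerreSeries_nonneg (hF : ∀ k, 0 ≤ F k) (hs : Summable F)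
    (hpsd : ∀ m, (momentMatrix m F).PosSemidef) {x : ℝ} (hx : 0 ≤ x) :
    0 ≤ laguerreSeries F x := by
  refine nonneg_of_integral_sq_nonneg (continuousOn_laguerreSeries hF hs)
    (abs_laguerreSeries_le hF hs) (fun p => ?_) hx
  set d := p.natDegree
  have hp (x : ℝ) : p.eval x = ∑ i : Fin (d + 1), p.coeff i * x ^ i.val := by
    rw [Polynomial.eval_eq_sum_range, Finset.sum_range]
  have hsub := (hpsd (2 * d)).submatrix
    (fun i : Fin (d + 1) => (⟨2 * i.val, by omega⟩ : Fin (2 * d + 1)))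
  have hquad := hsub.dotProduct_mulVec_nonneg fun i => p.coeff i
  convert! hquad using 1
  have hint (i j : Fin (d + 1)) := (integrableOn_mul_laguerreSeries hF hs
    (Subexponential.id.pow (i.val + j.val))).const_mul (p.coeff i * p.coeff j)
  have hpt (x : ℝ) : p.eval x ^ 2 * (laguerreSeries F x * Real.exp (-x / 2)) =
      ∑ i : Fin (d + 1), ∑ j : Fin (d + 1), p.coeff i * p.coeff j *
        (x ^ (i.val + j.val) * (laguerreSeries F x * Real.exp (-x / 2))) := by
    rw [sq, hp, Finset.sum_mul_sum, Finset.sum_mul]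
    refine Finset.sum_congr rfl fun i _ => ?_
    rw [Finset.sum_mul]
    refine Finset.sum_congr rfl fun j _ => ?_
    rw [pow_add]
    ring
  simp only [hpt]
  rw [integral_finsetSum _ fun i _ => integrable_finsetSum _ fun j _ => hint i j]
  simp only [dotProduct, Matrix.mulVec, Finset.mul_sum, star_trivial]
  refine Finset.sum_congr rfl fun i _ => ?_
  rw [integral_finsetSum _ fun j _ => hint i j]
  refine Finset.sum_congr rfl fun j _ => ?_
  rw [integral_const_mul, integral_pow_mul_laguerreSeries hF hs]
  simp only [momentMatrix, Matrix.submatrix_apply, Matrix.of_apply]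
  rw [if_neg (by omega), show (2 * i.val + 2 * j.val) / 2 = i.val + j.val by omega]
  ring

end Series

/-- Feasibility for the semidefinite relaxation of order `m`, with the normalization
`∑ F_k = 1` weakened to `∑ F_k ≤ 1`. -/
def RelaxFeasible (m : ℕ) (F : ℕ → ℝ) : Prop :=
  (∀ k ≤ m, 0 ≤ F k) ∧ ∑ k ∈ Finset.range (m + 1), F k ≤ 1 ∧ (momentMatrix m F).PosSemidef

theorem laguerreMoment_smul (s : ℝ) (F : ℕ → ℝ) (l : ℕ) :
    laguerreMoment (fun k => s * F k) l = s * laguerreMoment F l := by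
  simp only [laguerreMoment, Finset.mul_sum, mul_assoc]

theorem momentMatrix_smul (m : ℕ) (s : ℝ) (F : ℕ → ℝ) :
    momentMatrix m (fun k => s * F k) = s • momentMatrix m F := by
  ext i j
  simp [momentMatrix, laguerreMoment_smul]

theorem momentMatrix_submatrix_castLE {m m' : ℕ} (h : m ≤ m') (F : ℕ → ℝ) :
    (momentMatrix m' F).submatrix (Fin.castLE (Nat.succ_le_succ h))
      (Fin.castLE (Nat.succ_le_succ h)) = momentMatrix m F := by
  ext i j
  simp [momentMatrix]

theorem momentMatrix_congr {m : ℕ} {F G : ℕ → ℝ} (h : ∀ k ≤ m, F k = G k) :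
    momentMatrix m F = momentMatrix m G := by
  ext i j
  have hl : laguerreMoment F ((i.val + j.val) / 2) = laguerreMoment G ((i.val + j.val) / 2) := by
    refine Finset.sum_congr rfl fun k hk => ?_
    rw [Finset.mem_range] at hk
    rw [h k (by omega)]
  simp [momentMatrix, hl]

theorem isClosed_momentMatrix_posSemidef (m : ℕ) :
    IsClosed {F : ℕ → ℝ | (momentMatrix m F).PosSemidef} := by
  have hcont (i j) : Continuous fun F : ℕ → ℝ => momentMatrix m F i j := by
    by_cases hij : (i.val + j.val) % 2 = 1
    · simp only [momentMatrix, Matrix.of_apply, hij, if_true]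
      fun_prop
    · simp only [momentMatrix, Matrix.of_apply, hij, if_false, laguerreMoment]
      fun_prop
  have hset : {F : ℕ → ℝ | (momentMatrix m F).PosSemidef} =
      ⋂ c : Fin (m + 1) → ℝ, {F | 0 ≤ star c ⬝ᵥ (momentMatrix m F).mulVec c} := by
    ext F
    rw [mem_iInter]
    exact ⟨fun h => h.dotProduct_mulVec_nonneg,
      fun h => .of_dotProduct_mulVec_nonneg (momentMatrix_isHermitian m F) h⟩
  rw [hset]
  refine isClosed_iInter fun c => isClosed_le continuous_const ?_
  simp only [dotProduct, Matrix.mulVec]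
  fun_prop

theorem isClosed_relaxFeasible (m : ℕ) : IsClosed {F : ℕ → ℝ | RelaxFeasible m F} := by
  have hset : {F : ℕ → ℝ | RelaxFeasible m F} =
      (⋂ k, ⋂ _ : k ≤ m, {F : ℕ → ℝ | 0 ≤ F k}) ∩
        ({F : ℕ → ℝ | ∑ k ∈ Finset.range (m + 1), F k ≤ 1} ∩
          {F | (momentMatrix m F).PosSemidef}) := by
    ext F
    simp [RelaxFeasible]
  rw [hset]
  refine IsClosed.inter ?_ (IsClosed.inter ?_ (isClosed_momentMatrix_posSemidef m))
  · exact isClosed_iInter fun k => isClosed_iInter fun _ =>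
      isClosed_le continuous_const (continuous_apply k)
  · exact isClosed_le (by fun_prop) continuous_const

namespace RelaxFeasible

theorem zero (m : ℕ) : RelaxFeasible m 0 := by
  have h : momentMatrix m 0 = 0 := by
    ext i j
    simp [momentMatrix, laguerreMoment]
  exact ⟨fun _ _ => le_rfl, by simp, h ▸ Matrix.PosSemidef.zero⟩

theorem mono {m m' : ℕ} (h : m ≤ m') {F : ℕ → ℝ} (hF : RelaxFeasible m' F) :
    RelaxFeasible m F := by
  obtain ⟨h0, h1, h2⟩ := hF
  refine ⟨fun k hk => h0 k (hk.trans h), le_trans ?_ h1, ?_⟩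
  · refine Finset.sum_le_sum_of_subset_of_nonneg
      (Finset.range_mono (Nat.succ_le_succ h)) fun k hk _ => h0 k ?_
    exact Nat.lt_succ_iff.1 (Finset.mem_range.1 hk)
  · rw [← momentMatrix_submatrix_castLE h]
    exact h2.submatrix _

end RelaxFeasible

theorem le_sdpRelaxVal {n m : ℕ} (hnm : n ≤ m) {F : ℕ → ℝ} (hF : RelaxFeasible m F) :
    F n ≤ sdpRelaxVal n m := by
  obtain ⟨h0, h1, h2⟩ := hF
  have hmem (k : ℕ) (hk : k ∈ Finset.range (m + 1)) : 0 ≤ F k :=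
    h0 k (Nat.lt_succ_iff.1 (Finset.mem_range.1 hk))
  have hn : n ∈ Finset.range (m + 1) := Finset.mem_range.2 (Nat.lt_succ_iff.2 hnm)
  have hle := Finset.single_le_sum hmem hn
  set s := ∑ k ∈ Finset.range (m + 1), F k with hs
  rcases (Finset.sum_nonneg hmem).eq_or_lt with h | hspos
  · rw [← hs] at h
    refine (hle.trans h.ge).trans (Real.sSup_nonneg ?_)
    rintro v ⟨A, G, -, -, hG, -, -, rfl⟩
    exact hG n hnm
  · rw [← hs] at hspos
    refine le_trans (b := s⁻¹ * F n) ?_ (le_csSup ?_ ?_)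
    · exact le_mul_of_one_le_left (h0 n hnm) ((one_le_inv₀ hspos).2 h1)
    · refine ⟨1, ?_⟩
      rintro v ⟨A, G, -, hG1, hG, -, -, rfl⟩
      rw [← hG1]
      exact Finset.single_le_sum
        (fun k hk => hG k (Nat.lt_succ_iff.1 (Finset.mem_range.1 hk))) hn
    · refine ⟨momentMatrix m fun k => s⁻¹ * F k, fun k => s⁻¹ * F k, ?_, ?_, ?_, ?_, ?_, rfl⟩
      · rw [momentMatrix_smul]
        exact h2.smul (inv_nonneg.2 hspos.le)
      · rw [← Finset.mul_sum, ← hs, inv_mul_cancel₀ hspos.ne']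
      · exact fun k hk => mul_nonneg (inv_nonneg.2 hspos.le) (h0 k hk)
      · intro i j l hij
        simp only [momentMatrix, Matrix.of_apply]
        rw [if_neg (by omega), hij, Nat.mul_div_cancel_left l two_pos, laguerreMoment]
      · intro i j hij
        simp [momentMatrix, hij]

theorem exists_relaxFeasible_of_lt_sdpRelaxVal {n m : ℕ} {L : ℝ}
    (hL : L < sdpRelaxVal n m) : ∃ F, RelaxFeasible m F ∧ L < F n := by
  rw [sdpRelaxVal] at hL
  set S := {v : ℝ | _}
  rcases S.eq_empty_or_nonempty with h | h
  · rw [h, Real.sSup_empty] at hL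
    exact ⟨0, RelaxFeasible.zero m, hL⟩
  · obtain ⟨v, ⟨A, F, hA, h1, h0, heven, hodd, rfl⟩, hv⟩ := exists_lt_of_lt_csSup h hL
    refine ⟨F, ⟨h0, h1.le, ?_⟩, hv⟩
    have hAF : momentMatrix m F = A := by
      ext i j
      by_cases hij : (i.val + j.val) % 2 = 1
      · simp [momentMatrix, hij, hodd i j hij]
      · rw [heven i j ((i.val + j.val) / 2) (by omega)]
        simp [momentMatrix, hij, laguerreMoment]
    rwa [hAF]

theorem sdpRelaxVal_anti {n m m' : ℕ} (hnm : n ≤ m) (h : m ≤ m') :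
    sdpRelaxVal n m' ≤ sdpRelaxVal n m := by
  refine le_of_forall_lt fun L hL => ?_
  obtain ⟨F, hF, hLF⟩ := exists_relaxFeasible_of_lt_sdpRelaxVal hL
  exact hLF.trans_le (le_sdpRelaxVal hnm (hF.mono h))

theorem sdpRelaxVal_nonneg {n m : ℕ} (hnm : n ≤ m) : 0 ≤ sdpRelaxVal n m :=
  le_sdpRelaxVal hnm (RelaxFeasible.zero m)

theorem lpVal_le_sdpRelaxVal {n m : ℕ} (hnm : n ≤ m) : lpVal n ≤ sdpRelaxVal n m := by
  refine Real.sSup_le ?_ (sdpRelaxVal_nonneg hnm)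
  rintro v ⟨F, h0, h1, hpos, rfl⟩
  have hs : Summable F := by
    by_contra hs
    rw [tsum_eq_zero_of_not_summable hs] at h1
    exact zero_ne_one h1
  refine le_sdpRelaxVal hnm ⟨fun k _ => h0 k, ?_, momentMatrix_posSemidef h0 hs hpos m⟩
  rw [← h1]
  exact hs.sum_le_tsum _ fun k _ => h0 k

theorem le_lpVal {F : ℕ → ℝ} (hF : ∀ m, RelaxFeasible m F) (n : ℕ) : F n ≤ lpVal n := by
  have h0 (k : ℕ) : 0 ≤ F k := (hF k).1 k le_rfl
  have hpart (N : ℕ) : ∑ k ∈ Finset.range N, F k ≤ 1 :=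
    (Finset.sum_le_sum_of_subset_of_nonneg (Finset.range_mono N.le_succ)
      fun k _ _ => h0 k).trans (hF N).2.1
  have hs : Summable F := summable_of_sum_range_le h0 hpart
  have h1 : ∑' k, F k ≤ 1 := Real.tsum_le_of_sum_range_le h0 hpart
  have hle : F n ≤ ∑' k, F k := hs.le_tsum n fun k _ => h0 k
  rcases (tsum_nonneg h0).eq_or_lt with h | hpos
  · refine (hle.trans h.ge).trans (Real.sSup_nonneg ?_)
    rintro v ⟨G, hG, -, -, rfl⟩
    exact hG n
  · set s := ∑' k, F k with hsdef
    refine le_trans (b := s⁻¹ * F n) ?_ (le_csSup ?_ ?_)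
    · exact le_mul_of_one_le_left (h0 n) ((one_le_inv₀ hpos).2 h1)
    · refine ⟨1, ?_⟩
      rintro v ⟨G, hG, hG1, -, rfl⟩
      have hsG : Summable G := by
        by_contra hsG
        rw [tsum_eq_zero_of_not_summable hsG] at hG1
        exact zero_ne_one hG1
      rw [← hG1]
      exact hsG.le_tsum n fun k _ => hG k
    · refine ⟨fun k => s⁻¹ * F k, fun k => mul_nonneg (inv_nonneg.2 hpos.le) (h0 k), ?_, ?_, rfl⟩
      · rw [tsum_mul_left, ← hsdef, inv_mul_cancel₀ hpos.ne']
      · intro x hx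
        simp only [mul_assoc]
        rw [tsum_mul_left]
        exact mul_nonneg (inv_nonneg.2 hpos.le)
          (laguerreSeries_nonneg h0 hs (fun m => (hF m).2.2) hx)

/-- If every relaxation has value above `L`, compactness yields a common feasible point. -/
theorem le_lpVal_of_forall_lt_sdpRelaxVal {n : ℕ} {L : ℝ}
    (hL : ∀ m, n ≤ m → L < sdpRelaxVal n m) : L ≤ lpVal n := by
  set t : ℕ → Set (ℕ → ℝ) := fun i =>
    (Set.univ.pi fun _ => Icc (0 : ℝ) 1) ∩ {F | RelaxFeasible (n + i) F ∧ L ≤ F n}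
  have hbox : IsCompact (Set.univ.pi fun _ : ℕ => Icc (0 : ℝ) 1) :=
    isCompact_univ_pi fun _ => isCompact_Icc
  have hclosed (i : ℕ) : IsClosed (t i) := by
    exact hbox.isClosed.inter ((isClosed_relaxFeasible (n + i)).inter
      (isClosed_le continuous_const (continuous_apply n)))
  have hne (i : ℕ) : (t i).Nonempty := by
    obtain ⟨F, ⟨h0, h1, h2⟩, hLF⟩ :=
      exists_relaxFeasible_of_lt_sdpRelaxVal (hL (n + i) (Nat.le_add_right n i))
    set G : ℕ → ℝ := fun k => if k ≤ n + i then F k else 0 with hG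
    have hGF (k : ℕ) (hk : k ≤ n + i) : G k = F k := if_pos hk
    have hsum : ∑ k ∈ Finset.range (n + i + 1), G k = ∑ k ∈ Finset.range (n + i + 1), F k :=
      Finset.sum_congr rfl fun k hk => hGF k (Nat.lt_succ_iff.1 (Finset.mem_range.1 hk))
    refine ⟨G, fun k _ => ?_, ⟨fun k hk => ?_, ?_, ?_⟩, ?_⟩
    · by_cases hk : k ≤ n + i
      · rw [hGF k hk]
        refine ⟨h0 k hk, le_trans ?_ h1⟩
        exact Finset.single_le_sum
          (fun k hk => h0 k (Nat.lt_succ_iff.1 (Finset.mem_range.1 hk)))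
          (Finset.mem_range.2 (Nat.lt_succ_iff.2 hk))
      · simp [hG, hk]
    · rw [hGF k hk]
      exact h0 k hk
    · rwa [hsum]
    · rwa [momentMatrix_congr hGF]
    · rw [hGF n (Nat.le_add_right n i)]
      exact hLF.le
  obtain ⟨F, hF⟩ := IsCompact.nonempty_iInter_of_sequence_nonempty_isCompact_isClosed t
    (fun i F hF => ⟨hF.1, hF.2.1.mono (by omega), hF.2.2⟩) hne
    (hbox.of_isClosed_subset (hclosed 0) inter_subset_left) hclosed
  rw [mem_iInter] at hF
  exact (hF 0).2.2.trans (le_lpVal (fun m => (hF m).2.1.mono (Nat.le_add_left m n)) n)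

/-- for `n ≥ 1`, the sequence of optimal values of the semidefinite
relaxations is nonincreasing (for `m ≥ n`) and converges to the optimal value of the
linear program `(LP^{L²}_n)`. -/
theorem relaxation_hierarchy_converges (n : ℕ) (hn : 1 ≤ n) :
    (∀ m m' : ℕ, n ≤ m → m ≤ m' → sdpRelaxVal n m' ≤ sdpRelaxVal n m) ∧
    Filter.Tendsto (fun m => sdpRelaxVal n m) Filter.atTop (nhds (lpVal n)) := by
  refine ⟨fun m m' hm hmm' => sdpRelaxVal_anti hm hmm', ?_⟩
  rw [tendsto_order]
  refine ⟨fun a ha => ?_, fun a ha => ?_⟩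
  · filter_upwards [eventually_ge_atTop n] with m hm
    exact ha.trans_le (lpVal_le_sdpRelaxVal hm)
  · obtain ⟨L, hL, hLa⟩ := exists_between ha
    have hex : ∃ m, n ≤ m ∧ sdpRelaxVal n m ≤ L := by
      by_contra! hcon
      exact absurd (le_lpVal_of_forall_lt_sdpRelaxVal hcon) (not_le.2 hL)
    obtain ⟨m, hm, hmL⟩ := hex
    filter_upwards [eventually_ge_atTop m] with m' hm'
    exact (sdpRelaxVal_anti hm hm').trans_lt (hmL.trans_lt hLa)
end

section
/- For every integer n ≥ 1, the sequence (ω_n^{m,≤})_{m ≥ n} of optimal values of the semidefinite restrictions (SDP^{m,≤}_n) is nondecreasing and converges, as m → ∞, to ω_n^{𝒮}, the optimal value of the linear program (LP^{𝒮}_n) over rapidly decreasing sequences. -/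
/-- `ω_n^{𝒮}`: the optimal value of the linear program `(LP^{𝒮}_n)` over rapidly
decreasing sequences. -/
noncomputable def lpSchwartzVal (n : ℕ) : ℝ :=
  sSup {v : ℝ | ∃ F : ℕ → ℝ,
    (∀ p : ℕ, ∃ C : ℝ, ∀ k : ℕ, (k : ℝ) ^ p * |F k| ≤ C) ∧
    (∀ k, 0 ≤ F k) ∧ (∑' k, F k) = 1 ∧
    (∀ x : ℝ, 0 ≤ x → 0 ≤ ∑' k, F k * laguerreFun k x) ∧ v = F n}

/-- `ω_n^{m,≤}`: the optimal value of the semidefinite restriction `(SDP^{m,≤}_n)`. -/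
noncomputable def sdpRestrVal (n m : ℕ) : ℝ :=
  sSup {v : ℝ | ∃ (Q : Matrix (Fin (m + 1)) (Fin (m + 1)) ℝ) (F : ℕ → ℝ),
    Q.PosSemidef ∧
    (∑ k ∈ Finset.range (m + 1), F k) = 1 ∧
    (∀ k ≤ m, 0 ≤ F k) ∧
    (∀ l, 1 ≤ l → l ≤ m →
      (∑ i : Fin (m + 1), ∑ j : Fin (m + 1),
        if i.val + j.val = 2 * l - 1 then Q i j else 0) = 0) ∧
    (∀ l ≤ m,
      (∑ i : Fin (m + 1), ∑ j : Fin (m + 1),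
        if i.val + j.val = 2 * l then Q i j else 0)
      = ∑ k ∈ Finset.Icc l m,
          ((-1 : ℝ) ^ (k + l) / (l.factorial : ℝ)) * (k.choose l : ℝ) * F k) ∧
    v = F n}

open Polynomial

/-- The `k`-th Laguerre polynomial as an element of `ℝ[X]`. -/
noncomputable def laguerrePoly (k : ℕ) : ℝ[X] :=
  ∑ l ∈ Finset.range (k + 1), monomial l ((-1 : ℝ) ^ l / (l.factorial : ℝ) * (k.choose l : ℝ))

lemma laguerrePoly_coeff (k l : ℕ) :
    (laguerrePoly k).coeff l = (-1 : ℝ) ^ l / (l.factorial : ℝ) * (k.choose l : ℝ) := by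
  simp only [laguerrePoly, finsetSum_coeff, coeff_monomial]
  rw [Finset.sum_ite_eq']
  split_ifs with h
  · rfl
  · rw [Nat.choose_eq_zero_of_lt (by simpa [Nat.lt_succ_iff] using h)]
    simp

lemma laguerrePoly_eval (k : ℕ) (x : ℝ) : (laguerrePoly k).eval x = laguerreL k x := by
  simp [laguerrePoly, laguerreL, eval_finsetSum]

lemma laguerrePoly_eval_zero (k : ℕ) : (laguerrePoly k).eval 0 = 1 := by
  rw [← coeff_zero_eq_eval_zero, laguerrePoly_coeff]
  simp

/-- Laguerre's differential equation `x y'' + (1 - x) y' + k y = 0`. -/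
lemma laguerrePoly_ode (k : ℕ) :
    X * derivative (derivative (laguerrePoly k)) + (1 - X) * derivative (laguerrePoly k)
      + C (k : ℝ) * laguerrePoly k = 0 := by
  have key : ∀ l : ℕ, ((l : ℝ) + 1) ^ 2 * (laguerrePoly k).coeff (l + 1)
      = -((k : ℝ) - l) * (laguerrePoly k).coeff l := by
    intro l
    have hc : ((k.choose (l + 1) : ℕ) : ℝ) * (l + 1) = (k.choose l : ℝ) * ((k : ℝ) - l) := by
      rcases le_or_gt l k with h | h
      · have := Nat.choose_succ_right_eq k l
        rw [← Nat.cast_sub h]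
        exact_mod_cast this
      · rw [Nat.choose_eq_zero_of_lt h, Nat.choose_eq_zero_of_lt (by omega : k < l + 1)]
        simp
    have hl : (l.factorial : ℝ) ≠ 0 := by positivity
    have hl' : (l : ℝ) + 1 ≠ 0 := by positivity
    rw [laguerrePoly_coeff, laguerrePoly_coeff, Nat.factorial_succ]
    push_cast
    field_simp
    linear_combination (-1) * (-1 : ℝ) ^ l * hc
  ext l
  rcases l with _ | l
  · have := key 0
    simp [sub_mul, coeff_derivative] at this ⊢
    linarith
  · have := key (l + 1)
    push_cast at this
    simp only [sub_mul, one_mul, coeff_add, coeff_sub, coeff_X_mul, coeff_derivative, coeff_C_mul,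
      coeff_zero]
    push_cast
    linear_combination this

/-- A polynomial bound on the Laguerre functions, uniform in `x ≥ 0`. -/
lemma abs_laguerreFun_le (k : ℕ) {x : ℝ} (hx : 0 ≤ x) : |laguerreFun k x| ≤ 2 * k + 1 := by
  set y : ℝ → ℝ := fun t => (laguerrePoly k).eval t with hy
  set y' : ℝ → ℝ := fun t => (derivative (laguerrePoly k)).eval t with hy'
  set y'' : ℝ → ℝ := fun t => (derivative (derivative (laguerrePoly k))).eval t with hy''
  have d0 : ∀ t, HasDerivAt y (y' t) t := fun t => (laguerrePoly k).hasDerivAt t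
  have d1 : ∀ t, HasDerivAt y' (y'' t) t := fun t => (derivative (laguerrePoly k)).hasDerivAt t
  have dexp : ∀ t : ℝ, HasDerivAt (fun t => Real.exp (-t)) (-Real.exp (-t)) t := fun t => by
    simpa using (hasDerivAt_neg t).exp
  have ode : ∀ t, t * y'' t + (1 - t) * y' t + k * y t = 0 := fun t => by
    simpa [hy, hy', hy''] using congrArg (eval t) (laguerrePoly_ode k)
  set W : ℝ → ℝ := fun t => Real.exp (-t) * (t * y' t ^ 2 - t * (y t * y' t) + k * y t ^ 2) with hW
  have dW : ∀ t, HasDerivAt W (-(Real.exp (-t) * y' t ^ 2)) t := fun t => by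
    have h := (dexp t).mul ((((hasDerivAt_id t).mul ((d1 t).pow 2)).sub
      ((hasDerivAt_id t).mul ((d0 t).mul (d1 t)))).add (((d0 t).pow 2).const_mul (k : ℝ)))
    refine HasDerivAt.congr_deriv h ?_
    simp only [id, Pi.add_apply, Pi.sub_apply, Pi.mul_apply, Pi.pow_apply]
    push_cast
    linear_combination Real.exp (-t) * (2 * y' t - y t) * ode t
  have dE : ∀ t, HasDerivAt (fun t => W t + Real.exp (-t) * (y t ^ 2 / 2))
      (-(Real.exp (-t) * ((y' t - y t / 2) ^ 2 + y t ^ 2 / 4))) t := fun t => by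
    refine HasDerivAt.congr_deriv ((dW t).add ((dexp t).mul (((d0 t).pow 2).div_const 2))) ?_
    push_cast
    ring
  have hWanti : Antitone W := antitone_of_hasDerivAt_nonpos dW fun t =>
    neg_nonpos.2 (by positivity)
  have hEanti := antitone_of_hasDerivAt_nonpos dE fun t =>
    neg_nonpos.2 (by positivity)
  have hWlim : Filter.Tendsto W Filter.atTop (nhds 0) := by
    have := (X * derivative (laguerrePoly k) ^ 2
      - X * (laguerrePoly k * derivative (laguerrePoly k))
      + C (k : ℝ) * laguerrePoly k ^ 2).tendsto_div_exp_atTop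
    refine this.congr fun t => ?_
    simp [hW, hy, hy', Real.exp_neg, div_eq_inv_mul]
  have hW0 : 0 ≤ W x := hWanti.le_of_tendsto hWlim x
  have hE := hEanti hx
  have hy0 : y 0 = 1 := laguerrePoly_eval_zero k
  have h1 : Real.exp (-x) * y x ^ 2 ≤ 2 * k + 1 := by
    simp only [hW, hy0, neg_zero, Real.exp_zero] at hE hW0
    linarith
  have h2 : laguerreFun k x ^ 2 = Real.exp (-x) * y x ^ 2 := by
    have he : Real.exp (-x / 2) ^ 2 = Real.exp (-x) := by
      rw [← Real.exp_nat_mul]; congr 1; push_cast; ring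
    rw [laguerreFun, mul_pow, mul_pow, ← pow_mul, mul_comm k 2, pow_mul, he,
      ← laguerrePoly_eval]
    simp [hy, mul_comm]
  have hk : (0 : ℝ) ≤ k := k.cast_nonneg
  refine abs_le_of_sq_le_sq ?_ (by positivity)
  nlinarith

/-- The umbral functional `X ^ j ↦ x ^ j / j!`. -/
noncomputable def expUmbra (x : ℝ) : ℝ[X] →ₗ[ℝ] ℝ :=
  lsum fun j => LinearMap.mulRight ℝ (x ^ j / (j.factorial : ℝ))

lemma expUmbra_X_pow (x : ℝ) (l : ℕ) : expUmbra x (X ^ l) = x ^ l / (l.factorial : ℝ) := by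
  simp [expUmbra, lsum_apply, ← monomial_one_right_eq_X_pow, sum_monomial_index]

lemma expUmbra_X_sub_one_pow (x : ℝ) (k : ℕ) :
    expUmbra x ((X - 1) ^ k) = (-1) ^ k * laguerreL k x := by
  have h : ((X - 1 : ℝ[X]) ^ k) =
      ∑ l ∈ Finset.range (k + 1), ((-1 : ℝ) ^ (k + l) * (k.choose l : ℝ)) • X ^ l := by
    rw [sub_eq_add_neg, add_pow]
    refine Finset.sum_congr rfl fun l hl => ?_
    have hl' : l ≤ k := by simpa [Nat.lt_succ_iff] using hl
    have hs : (-1 : ℝ) ^ (k + l) = (-1) ^ (k - l) := by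
      obtain ⟨d, rfl⟩ := Nat.exists_eq_add_of_le hl'
      rw [show l + d + l = 2 * l + d by ring, pow_add, pow_mul]
      simp
    rw [hs, smul_eq_C_mul]
    simp only [map_mul, map_pow, map_neg, map_one, map_natCast]
    ring
  rw [h, map_sum, laguerreL, Finset.mul_sum]
  refine Finset.sum_congr rfl fun l _ => ?_
  rw [map_smul, expUmbra_X_pow, smul_eq_mul, pow_add]
  ring

/-- Monomials have nonnegative coefficients in the basis of signed Laguerre polynomials. -/
lemma pow_div_factorial_eq_sum_laguerreL (x : ℝ) {l M : ℕ} (hl : l ≤ M) :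
    x ^ l / (l.factorial : ℝ)
      = ∑ k ∈ Finset.range (M + 1), (l.choose k : ℝ) * ((-1) ^ k * laguerreL k x) := by
  have h : (X : ℝ[X]) ^ l = ∑ k ∈ Finset.range (l + 1), (l.choose k : ℝ) • (X - 1) ^ k := by
    conv_lhs => rw [← sub_add_cancel (X : ℝ[X]) 1, add_pow]
    refine Finset.sum_congr rfl fun k _ => ?_
    simp [smul_eq_C_mul, mul_comm]
  rw [← expUmbra_X_pow, h, map_sum]
  simp only [map_smul, expUmbra_X_sub_one_pow, smul_eq_mul]
  refine Finset.sum_subset (Finset.range_mono (by omega)) fun k _ hk => ?_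
  rw [Nat.choose_eq_zero_of_lt (by simpa using hk)]
  simp

/-- An alternating sum of a nondecreasing sequence has the sign of its last term. -/
lemma alternating_sum_mem_Icc {t : ℕ → ℝ} {k : ℕ} (h0 : 0 ≤ t 0)
    (ht : ∀ l < k, t l ≤ t (l + 1)) :
    0 ≤ (-1) ^ k * ∑ l ∈ Finset.range (k + 1), (-1) ^ l * t l ∧
      (-1) ^ k * ∑ l ∈ Finset.range (k + 1), (-1) ^ l * t l ≤ t k := by
  induction k with
  | zero => simpa using h0
  | succ k ih =>
    obtain ⟨ih1, ih2⟩ := ih fun l hl => ht l (by omega)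
    have hk := ht k (by omega)
    have hs : ((-1 : ℝ) ^ (k + 1)) * (-1) ^ (k + 1) = 1 := by rw [← mul_pow]; simp
    rw [Finset.sum_range_succ, mul_add, ← mul_assoc, hs, pow_succ]
    constructor <;> linarith

lemma laguerreFun_nonneg_of_sq_le {k : ℕ} {x : ℝ} (hx : (k : ℝ) ^ 2 ≤ x) :
    0 ≤ laguerreFun k x := by
  have hx0 : 0 ≤ x := (sq_nonneg _).trans hx
  refine mul_nonneg ?_ (Real.exp_pos _).le
  have := (alternating_sum_mem_Icc (t := fun l => x ^ l / (l.factorial : ℝ) * (k.choose l : ℝ))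
    (k := k) (by simp) ?_).1
  · have e : laguerreL k x = ∑ l ∈ Finset.range (k + 1),
        (-1) ^ l * (x ^ l / (l.factorial : ℝ) * (k.choose l : ℝ)) :=
      Finset.sum_congr rfl fun l _ => by ring
    rwa [e]
  · intro l hl
    have hc : ((k.choose (l + 1) : ℕ) : ℝ) * (l + 1) = (k.choose l : ℝ) * ((k - l : ℕ) : ℝ) :=
      mod_cast Nat.choose_succ_right_eq k l
    have hkl : (1 : ℝ) ≤ ((k - l : ℕ) : ℝ) := by
      exact_mod_cast (by omega : 1 ≤ k - l)
    have hlk : (l : ℝ) + 1 ≤ k := by exact_mod_cast hl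
    have hlx : ((l : ℝ) + 1) ^ 2 ≤ x := (pow_le_pow_left₀ (by positivity) hlk 2).trans hx
    have hcc : (k.choose (l + 1) : ℝ) = (k.choose l : ℝ) * ((k - l : ℕ) : ℝ) / (l + 1) := by
      rw [eq_div_iff (by positivity), hc]
    have e : x ^ (l + 1) / ((l + 1).factorial : ℝ) * (k.choose (l + 1) : ℝ)
        = x ^ l / (l.factorial : ℝ) * (k.choose l : ℝ)
          * (x * ((k - l : ℕ) : ℝ) / ((l : ℝ) + 1) ^ 2) := by
      rw [hcc, Nat.factorial_succ]
      push_cast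
      field_simp
      ring
    change x ^ l / (l.factorial : ℝ) * (k.choose l : ℝ)
      ≤ x ^ (l + 1) / ((l + 1).factorial : ℝ) * (k.choose (l + 1) : ℝ)
    rw [e]
    refine le_mul_of_one_le_right (by positivity) ?_
    rw [one_le_div (by positivity)]
    exact hlx.trans (le_mul_of_one_le_right hx0 hkl)

/-- Markov's inequality for the Poisson distribution, at twice its mean. -/
lemma half_exp_le_sum_range {t : ℝ} (ht : 0 ≤ t) {M : ℕ} (hM : 2 * t ≤ M) :
    Real.exp t / 2 ≤ ∑ l ∈ Finset.range (M + 1), t ^ l / (l.factorial : ℝ) := by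
  set S := ∑ l ∈ Finset.range (M + 1), t ^ l / (l.factorial : ℝ) with hS
  have hexp : HasSum (fun l : ℕ => t ^ l / (l.factorial : ℝ)) (Real.exp t) := by
    rw [Real.exp_eq_exp_ℝ]; exact NormedSpace.expSeries_div_hasSum_exp t
  have htail := (hasSum_nat_add_iff' (M + 1)).2 hexp
  have hshift := ((hasSum_nat_add_iff' M).2 hexp).mul_left t
  have hle : ((M : ℝ) + 1) * (Real.exp t - S)
      ≤ t * (Real.exp t - ∑ l ∈ Finset.range M, t ^ l / (l.factorial : ℝ)) := by
    refine hasSum_le (fun l => ?_) (htail.mul_left ((M : ℝ) + 1)) hshift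
    have e : t ^ (l + (M + 1)) / ((l + (M + 1)).factorial : ℝ)
        = t * (t ^ (l + M) / ((l + M).factorial : ℝ)) / (l + M + 1) := by
      rw [← add_assoc, Nat.factorial_succ]
      push_cast
      field_simp
      ring
    rw [e, ← mul_div_assoc, div_le_iff₀ (by positivity), mul_comm]
    refine mul_le_mul_of_nonneg_left ?_ (by positivity)
    have : (0 : ℝ) ≤ l := l.cast_nonneg
    linarith
  have hpos : 0 ≤ ∑ l ∈ Finset.range M, t ^ l / (l.factorial : ℝ) :=
    Finset.sum_nonneg fun l _ => by positivity
  have he := Real.exp_pos t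
  have hSM : ((M : ℝ) + 1) * (Real.exp t - S) ≤ (M : ℝ) / 2 * Real.exp t := by
    refine hle.trans ?_
    nlinarith [mul_nonneg ht hpos]
  have hM0 : (0 : ℝ) ≤ M := M.cast_nonneg
  by_contra! hlt
  nlinarith

/-- A nonnegative real polynomial vanishing at `a` is divisible by `(X - a) ^ 2`, with a
nonnegative quotient. -/
lemma exists_eq_sq_mul_of_nonneg_of_isRoot {R : ℝ[X]} (hR : ∀ x, 0 ≤ R.eval x) {a : ℝ}
    (ha : R.eval a = 0) : ∃ S : ℝ[X], R = (X - C a) ^ 2 * S ∧ ∀ x, 0 ≤ S.eval x := by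
  obtain ⟨T, hT⟩ := dvd_iff_isRoot.2 (show R.IsRoot a from ha)
  have hmin : IsLocalMin (fun x => R.eval x) a :=
    Filter.Eventually.of_forall fun x => by simpa [ha] using hR x
  have hd : (derivative R).eval a = 0 := hmin.hasDerivAt_eq_zero (R.hasDerivAt a)
  have hTa : T.IsRoot a := by simpa [hT] using hd
  obtain ⟨S, hS⟩ := dvd_iff_isRoot.2 hTa
  have hRS : R = (X - C a) ^ 2 * S := by rw [hT, hS]; ring
  refine ⟨S, hRS, fun x => ?_⟩
  have hdense : Dense ({a}ᶜ : Set ℝ) := dense_compl_singleton a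
  have hsub : ({a}ᶜ : Set ℝ) ⊆ {x | 0 ≤ S.eval x} := fun z hz => by
    have h := hR z
    rw [hRS, eval_mul, eval_pow] at h
    have hza : 0 < (eval z (X - C a)) ^ 2 := by
      have : z - a ≠ 0 := sub_ne_zero.2 hz
      simpa using (sq_pos_of_ne_zero this)
    exact nonneg_of_mul_nonneg_right h hza
  exact (IsClosed.closure_subset_iff (isClosed_le continuous_const S.continuous)).2 hsub
    (hdense x)

/-- A nonnegative real polynomial of degree at most `2 * d` is a sum of `d + 1` squares of
polynomials of degree at most `d`. -/
lemma exists_sum_sq_of_nonneg (d : ℕ) (R : ℝ[X]) (hdeg : R.natDegree ≤ 2 * d)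
    (hR : ∀ x, 0 ≤ R.eval x) :
    ∃ q : Fin (d + 1) → ℝ[X], (∀ a, (q a).natDegree ≤ d) ∧ R = ∑ a, q a ^ 2 := by
  induction d generalizing R with
  | zero =>
    rw [eq_C_of_natDegree_le_zero hdeg] at hR ⊢
    refine ⟨fun _ => C (√(R.coeff 0)), fun _ => by simp, ?_⟩
    have h0 : 0 ≤ R.coeff 0 := by simpa using hR 0
    simp [← C_pow, Real.sq_sqrt h0]
  | succ d ih =>
    have hmin : ∃ a, ∀ x, R.eval a ≤ R.eval x := by
      rcases Nat.eq_zero_or_pos R.natDegree with h | h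
      · rw [eq_C_of_natDegree_eq_zero h]
        exact ⟨0, by simp⟩
      · refine R.continuous.exists_forall_le ?_
        have := R.tendsto_norm_atTop (natDegree_pos_iff_degree_pos.1 h)
          (tendsto_norm_cocompact_atTop (E := ℝ))
        refine this.congr fun x => ?_
        rw [Real.norm_of_nonneg (hR x)]
    obtain ⟨a, ha⟩ := hmin
    obtain ⟨S, hS, hS0⟩ := exists_eq_sq_mul_of_nonneg_of_isRoot (R := R - C (R.eval a)) (a := a)
      (fun x => by simpa using ha x) (by simp)
    have hSdeg : S.natDegree ≤ 2 * d := by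
      rcases eq_or_ne S 0 with rfl | hne
      · simp
      · have h1 : (R - C (R.eval a)).natDegree = 2 + S.natDegree := by
          rw [hS, ((monic_X_sub_C a).pow 2).natDegree_mul' hne,
            (monic_X_sub_C a).natDegree_pow, natDegree_X_sub_C]
        rw [natDegree_sub_C] at h1
        omega
    obtain ⟨q, hq, hSq⟩ := ih S hSdeg hS0
    refine ⟨Fin.cons (C √(R.eval a)) fun i => (X - C a) * q i, fun i => ?_, ?_⟩
    · refine Fin.cases (by simp) (fun i => ?_) i
      rw [Fin.cons_succ]
      refine natDegree_mul_le.trans ?_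
      rw [natDegree_X_sub_C]
      have := hq i
      omega
    · rw [Fin.sum_univ_succ]
      simp only [Fin.cons_zero, Fin.cons_succ, mul_pow, ← Finset.mul_sum, ← hSq, ← hS]
      rw [← C_pow, Real.sq_sqrt (hR a)]
      ring

/-- The sum over the antidiagonal `i + j = s` of the Gram matrix of a sum of squares. -/
lemma coeff_sum_sq {m N : ℕ} {q : Fin N → ℝ[X]} (hq : ∀ a, (q a).natDegree ≤ m) (s : ℕ) :
    (∑ i : Fin (m + 1), ∑ j : Fin (m + 1),
        if i.val + j.val = s then ∑ a, (q a).coeff i * (q a).coeff j else 0)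
      = (∑ a, q a ^ 2).coeff s := by
  have hexp : ∀ a, q a = ∑ i : Fin (m + 1), monomial (i : ℕ) ((q a).coeff i) := fun a => by
    rw [Fin.sum_univ_eq_sum_range (fun i => monomial i ((q a).coeff i))]
    exact (q a).as_sum_range' (m + 1) (Nat.lt_succ_of_le (hq a))
  have hsq : ∀ a, (q a ^ 2).coeff s = ∑ i : Fin (m + 1), ∑ j : Fin (m + 1),
      if i.val + j.val = s then (q a).coeff i * (q a).coeff j else 0 := fun a => by
    conv_lhs => rw [hexp a, sq, Finset.sum_mul_sum]
    simp only [finsetSum_coeff, monomial_mul_monomial, coeff_monomial]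
  rw [finsetSum_coeff]
  simp only [hsq]
  conv_rhs => rw [Finset.sum_comm]
  refine Finset.sum_congr rfl fun i _ => ?_
  conv_rhs => rw [Finset.sum_comm]
  refine Finset.sum_congr rfl fun j _ => ?_
  split_ifs <;> simp

/-- The quadratic form of `Q` on a vector of powers, grouped by antidiagonals. -/
lemma sum_mul_pow_add_eq {m : ℕ} (Q : Matrix (Fin (m + 1)) (Fin (m + 1)) ℝ) (y : ℝ) :
    ∑ i : Fin (m + 1), ∑ j : Fin (m + 1), Q i j * y ^ (i.val + j.val)
      = ∑ s ∈ Finset.range (2 * m + 1), (∑ i : Fin (m + 1), ∑ j : Fin (m + 1),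
          if i.val + j.val = s then Q i j else 0) * y ^ s := by
  simp only [Finset.sum_mul]
  conv_rhs => rw [Finset.sum_comm]
  refine Finset.sum_congr rfl fun i _ => ?_
  conv_rhs => rw [Finset.sum_comm]
  refine Finset.sum_congr rfl fun j _ => ?_
  have : i.val + j.val ∈ Finset.range (2 * m + 1) := by
    have := i.2
    have := j.2
    simp only [Finset.mem_range]
    omega
  simp [ite_mul, Finset.sum_ite_eq, this]

/-- The polynomial `∑_{k ≤ m} (-1)^k F_k L_k`. -/
noncomputable def signedLaguerreSum (F : ℕ → ℝ) (m : ℕ) : ℝ[X] :=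
  ∑ k ∈ Finset.range (m + 1), C ((-1) ^ k * F k) * laguerrePoly k

lemma signedLaguerreSum_coeff (F : ℕ → ℝ) (m l : ℕ) :
    (signedLaguerreSum F m).coeff l = ∑ k ∈ Finset.Icc l m,
      ((-1 : ℝ) ^ (k + l) / (l.factorial : ℝ)) * (k.choose l : ℝ) * F k := by
  simp only [signedLaguerreSum, finsetSum_coeff, coeff_C_mul, laguerrePoly_coeff]
  symm
  refine Finset.sum_subset_zero_on_sdiff (fun k hk => ?_) (fun k hk => ?_) fun k _ => ?_
  · simp only [Finset.mem_Icc] at hk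
    simp only [Finset.mem_range]
    omega
  · simp only [Finset.mem_sdiff, Finset.mem_range, Finset.mem_Icc] at hk
    rw [Nat.choose_eq_zero_of_lt (by omega)]
    simp
  · rw [pow_add]
    ring

lemma signedLaguerreSum_natDegree_le (F : ℕ → ℝ) (m : ℕ) :
    (signedLaguerreSum F m).natDegree ≤ m := by
  refine natDegree_le_iff_coeff_eq_zero.2 fun l hl => ?_
  rw [signedLaguerreSum_coeff, Finset.Icc_eq_empty (by omega), Finset.sum_empty]

lemma sum_mul_laguerreFun (F : ℕ → ℝ) (m : ℕ) (x : ℝ) :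
    ∑ k ∈ Finset.range (m + 1), F k * laguerreFun k x
      = (signedLaguerreSum F m).eval x * Real.exp (-x / 2) := by
  rw [signedLaguerreSum, eval_finsetSum, Finset.sum_mul]
  refine Finset.sum_congr rfl fun k _ => ?_
  rw [eval_C_mul, laguerrePoly_eval, laguerreFun]
  ring

lemma sum_mul_laguerreFun_nonneg_iff (F : ℕ → ℝ) (m : ℕ) (x : ℝ) :
    0 ≤ ∑ k ∈ Finset.range (m + 1), F k * laguerreFun k x
      ↔ 0 ≤ (signedLaguerreSum F m).eval x := by
  rw [sum_mul_laguerreFun, mul_nonneg_iff_of_pos_right (Real.exp_pos _)]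

/-- Probability vectors supported on `{0, …, m}` whose Laguerre series is nonnegative on the
half-line. -/
structure IsFiniteFeasible (m : ℕ) (F : ℕ → ℝ) : Prop where
  nonneg : ∀ k, 0 ≤ F k
  support : ∀ k, m < k → F k = 0
  sum_eq_one : ∑ k ∈ Finset.range (m + 1), F k = 1
  series_nonneg : ∀ x : ℝ, 0 ≤ x → 0 ≤ ∑ k ∈ Finset.range (m + 1), F k * laguerreFun k x

/-- A positive semidefinite Gram matrix certifies nonnegativity on the half-line. -/
lemma eval_nonneg_of_gram {m : ℕ} {Q : Matrix (Fin (m + 1)) (Fin (m + 1)) ℝ}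
    (hQ : Q.PosSemidef) {P : ℝ[X]} (hP : P.natDegree ≤ m)
    (hodd : ∀ l, 1 ≤ l → l ≤ m → (∑ i : Fin (m + 1), ∑ j : Fin (m + 1),
        if i.val + j.val = 2 * l - 1 then Q i j else 0) = 0)
    (heven : ∀ l ≤ m, (∑ i : Fin (m + 1), ∑ j : Fin (m + 1),
        if i.val + j.val = 2 * l then Q i j else 0) = P.coeff l)
    {x : ℝ} (hx : 0 ≤ x) : 0 ≤ P.eval x := by
  have hcoeff : ∀ s ∈ Finset.range (2 * m + 1), (∑ i : Fin (m + 1), ∑ j : Fin (m + 1),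
      if i.val + j.val = s then Q i j else 0) = (expand ℝ 2 P).coeff s := by
    intro s hs
    have hs' := Finset.mem_range.1 hs
    rw [coeff_expand two_pos]
    split_ifs with h
    · obtain ⟨l, rfl⟩ := h
      rw [heven l (by omega)]
      simp
    · have := hodd ((s + 1) / 2) (by omega) (by omega)
      rwa [show 2 * ((s + 1) / 2) - 1 = s by omega] at this
  have hquad := hQ.dotProduct_mulVec_nonneg fun i => √x ^ i.val
  have heq : (star fun i : Fin (m + 1) => √x ^ i.val) ⬝ᵥ
      Q.mulVec (fun i : Fin (m + 1) => √x ^ i.val) = P.eval x := by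
    have h1 : (star fun i : Fin (m + 1) => √x ^ i.val) ⬝ᵥ
        Q.mulVec (fun i : Fin (m + 1) => √x ^ i.val)
        = ∑ i : Fin (m + 1), ∑ j : Fin (m + 1), Q i j * √x ^ (i.val + j.val) := by
      simp only [dotProduct, Matrix.mulVec, Finset.mul_sum, Pi.star_apply, star_trivial]
      refine Finset.sum_congr rfl fun i _ => Finset.sum_congr rfl fun j _ => ?_
      rw [pow_add]
      ring
    have hdeg : (expand ℝ 2 P).natDegree < 2 * m + 1 := by
      rw [natDegree_expand]
      omega
    rw [h1, sum_mul_pow_add_eq, Finset.sum_congr rfl fun s hs => by rw [hcoeff s hs],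
      ← eval_eq_sum_range' hdeg, expand_eval, Real.sq_sqrt hx]
  rwa [heq] at hquad

/-- A polynomial which is nonnegative on the half-line has a positive semidefinite Gram matrix. -/
lemma exists_gram_of_eval_nonneg {m : ℕ} {P : ℝ[X]} (hP : P.natDegree ≤ m)
    (hpos : ∀ x, 0 ≤ x → 0 ≤ P.eval x) :
    ∃ Q : Matrix (Fin (m + 1)) (Fin (m + 1)) ℝ, Q.PosSemidef ∧
      (∀ l, 1 ≤ l → (∑ i : Fin (m + 1), ∑ j : Fin (m + 1),
        if i.val + j.val = 2 * l - 1 then Q i j else 0) = 0) ∧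
      ∀ l, (∑ i : Fin (m + 1), ∑ j : Fin (m + 1),
        if i.val + j.val = 2 * l then Q i j else 0) = P.coeff l := by
  obtain ⟨q, hq, hR⟩ := exists_sum_sq_of_nonneg m (expand ℝ 2 P)
    (by rw [natDegree_expand]; omega) fun x => by
      rw [expand_eval]
      exact hpos _ (sq_nonneg x)
  set B : Matrix (Fin (m + 1)) (Fin (m + 1)) ℝ := Matrix.of fun a i => (q a).coeff i with hB
  have hBB : ∀ i j, (B.conjTranspose * B) i j = ∑ a, (q a).coeff i * (q a).coeff j := fun i j => by
    simp [Matrix.mul_apply, hB]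
  refine ⟨B.conjTranspose * B, Matrix.posSemidef_conjTranspose_mul_self B, fun l hl => ?_,
    fun l => ?_⟩
  · simp only [hBB]
    rw [coeff_sum_sq hq, ← hR, coeff_expand two_pos, if_neg (by omega)]
  · simp only [hBB]
    rw [coeff_sum_sq hq, ← hR, coeff_expand two_pos, if_pos (by omega)]
    simp

/-- The semidefinite restriction optimizes over the finitely supported feasible points. -/
lemma sdpRestrVal_eq {n m : ℕ} (hnm : n ≤ m) :
    sdpRestrVal n m = sSup {v : ℝ | ∃ F, IsFiniteFeasible m F ∧ v = F n} := by
  rw [sdpRestrVal]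
  congr 1
  ext v
  constructor
  · rintro ⟨Q, F, hQ, hsum, hF, hodd, heven, rfl⟩
    set G : ℕ → ℝ := fun k => if k ≤ m then F k else 0 with hG
    have hGF : ∀ k ∈ Finset.range (m + 1), G k = F k := fun k hk =>
      if_pos (Nat.lt_succ_iff.1 (Finset.mem_range.1 hk))
    refine ⟨G, ⟨fun k => ?_, fun k hk => if_neg (by omega), ?_, fun x hx => ?_⟩,
      (if_pos hnm).symm⟩
    · by_cases h : k ≤ m
      · simpa [hG, h] using hF k h
      · simp [hG, h]
    · rw [Finset.sum_congr rfl hGF, hsum]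
    · rw [Finset.sum_congr rfl fun k hk => by rw [hGF k hk], sum_mul_laguerreFun_nonneg_iff]
      refine eval_nonneg_of_gram hQ (signedLaguerreSum_natDegree_le F m) hodd (fun l hl => ?_) hx
      rw [heven l hl, signedLaguerreSum_coeff]
  · rintro ⟨F, hF, rfl⟩
    obtain ⟨Q, hQ, hodd, heven⟩ := exists_gram_of_eval_nonneg
      (signedLaguerreSum_natDegree_le F m)
      fun x hx => (sum_mul_laguerreFun_nonneg_iff F m x).1 (hF.series_nonneg x hx)
    refine ⟨Q, F, hQ, hF.sum_eq_one, fun k _ => hF.nonneg k, fun l hl _ => hodd l hl,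
      fun l _ => ?_, rfl⟩
    rw [heven, signedLaguerreSum_coeff]

lemma IsFiniteFeasible.sum_range_eq {m m' : ℕ} {F : ℕ → ℝ} (hF : IsFiniteFeasible m F)
    (h : m ≤ m') (g : ℕ → ℝ) :
    ∑ k ∈ Finset.range (m' + 1), F k * g k = ∑ k ∈ Finset.range (m + 1), F k * g k := by
  symm
  refine Finset.sum_subset (Finset.range_mono (by omega)) fun k _ hk => ?_
  rw [hF.support k (by simpa using hk), zero_mul]

lemma IsFiniteFeasible.mono {m m' : ℕ} {F : ℕ → ℝ} (hF : IsFiniteFeasible m F) (h : m ≤ m') :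
    IsFiniteFeasible m' F where
  nonneg := hF.nonneg
  support k hk := hF.support k (by omega)
  sum_eq_one := by simpa [hF.sum_eq_one] using hF.sum_range_eq h fun _ => 1
  series_nonneg x hx := by
    rw [hF.sum_range_eq h]
    exact hF.series_nonneg x hx

lemma IsFiniteFeasible.le_one {m : ℕ} {F : ℕ → ℝ} (hF : IsFiniteFeasible m F) (n : ℕ) :
    F n ≤ 1 := by
  rcases le_or_gt n m with h | h
  · rw [← hF.sum_eq_one]
    exact Finset.single_le_sum (fun k _ => hF.nonneg k) (by simpa [Nat.lt_succ_iff] using h)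
  · rw [hF.support n h]
    exact zero_le_one

lemma isFiniteFeasible_single_zero (m : ℕ) : IsFiniteFeasible m (Pi.single 0 1) where
  nonneg k := by
    rcases eq_or_ne k 0 with rfl | h <;> simp [*]
  support k hk := by
    rw [Pi.single_eq_of_ne (by omega)]
  sum_eq_one := by simp
  series_nonneg x _ := by
    simp [Pi.single_apply, laguerreFun, laguerreL, Real.exp_nonneg]

/-- The coefficients of `∑_{l ≤ M} (x / 2)^l / l!` in the basis of signed Laguerre polynomials. -/
noncomputable def truncExpCoeff (M k : ℕ) : ℝ :=
  ∑ l ∈ Finset.range (M + 1), (l.choose k : ℝ) / 2 ^ l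

lemma truncExpCoeff_nonneg (M k : ℕ) : 0 ≤ truncExpCoeff M k :=
  Finset.sum_nonneg fun l _ => by positivity

lemma truncExpCoeff_eq_zero {M k : ℕ} (h : M < k) : truncExpCoeff M k = 0 :=
  Finset.sum_eq_zero fun l hl => by
    rw [Nat.choose_eq_zero_of_lt (by have := Finset.mem_range.1 hl; omega)]
    simp

lemma sum_truncExpCoeff (M : ℕ) : ∑ k ∈ Finset.range (M + 1), truncExpCoeff M k = M + 1 := by
  simp only [truncExpCoeff]
  rw [Finset.sum_comm]
  have : ∀ l ∈ Finset.range (M + 1),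
      ∑ k ∈ Finset.range (M + 1), (l.choose k : ℝ) / 2 ^ l = 1 := by
    intro l hl
    have hl' := Finset.mem_range.1 hl
    have h : ∑ k ∈ Finset.range (M + 1), (l.choose k : ℝ) = 2 ^ l := by
      rw [← Finset.sum_subset (Finset.range_mono (by omega : l + 1 ≤ M + 1)) fun k _ hk => by
        rw [Nat.choose_eq_zero_of_lt (by simpa using hk), Nat.cast_zero]]
      exact_mod_cast Nat.sum_range_choose l
    rw [← Finset.sum_div, h, div_self (by positivity)]
  rw [Finset.sum_congr rfl this]
  simp

lemma sum_truncExpCoeff_mul_laguerreFun (M : ℕ) (x : ℝ) :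
    ∑ k ∈ Finset.range (M + 1), truncExpCoeff M k * laguerreFun k x
      = (∑ l ∈ Finset.range (M + 1), (x / 2) ^ l / (l.factorial : ℝ)) * Real.exp (-x / 2) := by
  simp only [truncExpCoeff, Finset.sum_mul]
  rw [Finset.sum_comm]
  refine Finset.sum_congr rfl fun l hl => ?_
  have h := pow_div_factorial_eq_sum_laguerreL x (Nat.lt_succ_iff.1 (Finset.mem_range.1 hl))
  rw [div_pow, div_right_comm, h, Finset.sum_div, Finset.sum_mul]
  refine Finset.sum_congr rfl fun k _ => ?_
  rw [laguerreFun]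
  ring

lemma sum_truncExpCoeff_mul_laguerreFun_nonneg (M : ℕ) {x : ℝ} (hx : 0 ≤ x) :
    0 ≤ ∑ k ∈ Finset.range (M + 1), truncExpCoeff M k * laguerreFun k x := by
  rw [sum_truncExpCoeff_mul_laguerreFun]
  positivity

lemma half_le_sum_truncExpCoeff_mul_laguerreFun {M : ℕ} {x : ℝ} (hx : 0 ≤ x) (hxM : x ≤ M) :
    1 / 2 ≤ ∑ k ∈ Finset.range (M + 1), truncExpCoeff M k * laguerreFun k x := by
  rw [sum_truncExpCoeff_mul_laguerreFun]
  have h := half_exp_le_sum_range (t := x / 2) (by positivity) (M := M) (by linarith)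
  have he : Real.exp (x / 2) * Real.exp (-x / 2) = 1 := by
    rw [← Real.exp_add]
    simp [neg_div]
  calc (1 : ℝ) / 2 = Real.exp (x / 2) / 2 * Real.exp (-x / 2) := by linarith
    _ ≤ _ := mul_le_mul_of_nonneg_right h (Real.exp_pos _).le

/-- A truncated Laguerre series whose negative part is small becomes feasible after adding a
multiple of the truncated exponential. -/
lemma exists_isFiniteFeasible_of_neg_le {F : ℕ → ℝ} (hF : ∀ k, 0 ≤ F k) {m : ℕ} {τ : ℝ}
    (hτ : 0 ≤ τ)
    (hneg : ∀ x : ℝ, 0 ≤ x →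
      -(τ / ((m : ℝ) ^ 2 + 1)) ≤ ∑ k ∈ Finset.range (m + 1), F k * laguerreFun k x)
    (hmass : 0 < ∑ k ∈ Finset.range (m + 1), F k) :
    ∃ G, IsFiniteFeasible (m ^ 2) G ∧
      ∀ n ≤ m, F n / (∑ k ∈ Finset.range (m + 1), F k + 2 * τ) ≤ G n := by
  set δ : ℝ := 2 * (τ / ((m : ℝ) ^ 2 + 1)) with hδ
  have hδ0 : 0 ≤ δ := by positivity
  set D : ℝ := ∑ k ∈ Finset.range (m + 1), F k + 2 * τ with hD
  have hD0 : 0 < D := by positivity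
  have hm : m ≤ m ^ 2 := Nat.le_self_pow two_ne_zero m
  set T : ℕ → ℝ := fun k => if k ≤ m then F k else 0 with hT
  have hT0 : ∀ k, 0 ≤ T k := fun k => by
    simp only [hT]
    split_ifs
    exacts [hF k, le_rfl]
  have hTsum : ∀ g : ℕ → ℝ, ∑ k ∈ Finset.range (m ^ 2 + 1), T k * g k
      = ∑ k ∈ Finset.range (m + 1), F k * g k := by
    intro g
    symm
    refine Finset.sum_subset_zero_on_sdiff (Finset.range_mono (by omega)) (fun k hk => ?_)
      fun k hk => ?_
    · have : ¬ k ≤ m := by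
        simp only [Finset.mem_sdiff, Finset.mem_range] at hk
        omega
      simp [hT, this]
    · have : k ≤ m := Nat.lt_succ_iff.1 (Finset.mem_range.1 hk)
      simp [hT, this]
  have hGsum : ∀ g : ℕ → ℝ,
      ∑ k ∈ Finset.range (m ^ 2 + 1), (T k + δ * truncExpCoeff (m ^ 2) k) / D * g k
      = (∑ k ∈ Finset.range (m + 1), F k * g k
        + δ * ∑ k ∈ Finset.range (m ^ 2 + 1), truncExpCoeff (m ^ 2) k * g k) / D := by
    intro g
    rw [← hTsum, Finset.mul_sum, ← Finset.sum_add_distrib, Finset.sum_div]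
    refine Finset.sum_congr rfl fun k _ => ?_
    ring
  refine ⟨fun k => (T k + δ * truncExpCoeff (m ^ 2) k) / D,
    ⟨fun k => ?_, fun k hk => ?_, ?_, fun x hx => ?_⟩, fun n hn => ?_⟩
  · have := truncExpCoeff_nonneg (m ^ 2) k
    have := hT0 k
    positivity
  · have : ¬ k ≤ m := by omega
    simp [hT, this, truncExpCoeff_eq_zero hk]
  · have h := hGsum fun _ => 1
    simp only [mul_one] at h
    rw [h, sum_truncExpCoeff, div_eq_one_iff_eq hD0.ne', hD, hδ]
    push_cast
    field_simp
  · rw [hGsum]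
    refine div_nonneg ?_ hD0.le
    rcases le_total x ((m ^ 2 : ℕ) : ℝ) with h | h
    · have h1 := half_le_sum_truncExpCoeff_mul_laguerreFun hx h
      have h2 := mul_le_mul_of_nonneg_left h1 hδ0
      have h3 := hneg x hx
      linarith
    · refine add_nonneg (Finset.sum_nonneg fun k hk => mul_nonneg (hF k) ?_)
        (mul_nonneg hδ0 (sum_truncExpCoeff_mul_laguerreFun_nonneg _ hx))
      refine laguerreFun_nonneg_of_sq_le (le_trans ?_ h)
      exact_mod_cast Nat.pow_le_pow_left (Nat.lt_succ_iff.1 (Finset.mem_range.1 hk)) 2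
  · have := mul_nonneg hδ0 (truncExpCoeff_nonneg (m ^ 2) n)
    refine div_le_div_of_nonneg_right ?_ hD0.le
    simp only [hT, hn, if_true]
    linarith

lemma summable_mul_of_rapidlyDecreasing {F : ℕ → ℝ}
    (hdec : ∀ p : ℕ, ∃ C : ℝ, ∀ k : ℕ, (k : ℝ) ^ p * |F k| ≤ C) (hF : ∀ k, 0 ≤ F k) :
    Summable fun k : ℕ => F k * ((2 * (k : ℝ) + 1) * ((k : ℝ) ^ 2 + 1)) := by
  obtain ⟨A, hA⟩ := hdec 0
  obtain ⟨B, hB⟩ := hdec 5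
  have hs : Summable fun k : ℕ => 32 * (A + B) * (1 / ((k + 1 : ℕ) : ℝ) ^ 2) :=
    ((summable_nat_add_iff 1).2 (Real.summable_one_div_nat_pow.2 one_lt_two)).mul_left _
  refine hs.of_nonneg_of_le (fun k => mul_nonneg (hF k) (by positivity)) fun k => ?_
  have hk : (0 : ℝ) ≤ k := k.cast_nonneg
  have hA' := hA k
  have hB' := hB k
  rw [abs_of_nonneg (hF k)] at hA' hB'
  have h5 : ((k : ℝ) + 1) ^ 5 ≤ 16 * ((k : ℝ) ^ 5 + 1) := by
    have := add_pow_le hk zero_le_one 5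
    norm_num at this
    linarith
  have h3 : (2 * (k : ℝ) + 1) * ((k : ℝ) ^ 2 + 1) ≤ 2 * ((k : ℝ) + 1) ^ 3 := by
    nlinarith [sq_nonneg (k : ℝ)]
  push_cast
  rw [mul_one_div, le_div_iff₀ (by positivity)]
  calc F k * ((2 * (k : ℝ) + 1) * ((k : ℝ) ^ 2 + 1)) * ((k : ℝ) + 1) ^ 2
      ≤ F k * (2 * ((k : ℝ) + 1) ^ 3) * ((k : ℝ) + 1) ^ 2 := by
        gcongr
        exact hF k
    _ = 2 * (F k * ((k : ℝ) + 1) ^ 5) := by ring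
    _ ≤ 2 * (F k * (16 * ((k : ℝ) ^ 5 + 1))) := by
        gcongr
        exact hF k
    _ ≤ 32 * (A + B) := by linarith

/-- Every point of the linear program is approximated by finitely supported feasible points. -/
lemma exists_isFiniteFeasible_gt {F : ℕ → ℝ}
    (hdec : ∀ p : ℕ, ∃ C : ℝ, ∀ k : ℕ, (k : ℝ) ^ p * |F k| ≤ C) (hF : ∀ k, 0 ≤ F k)
    (hsum : ∑' k, F k = 1) (hpos : ∀ x : ℝ, 0 ≤ x → 0 ≤ ∑' k, F k * laguerreFun k x)
    (n : ℕ) {a : ℝ} (ha : a < F n) : ∃ M G, IsFiniteFeasible M G ∧ a < G n := by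
  set w : ℕ → ℝ := fun k => F k * ((2 * (k : ℝ) + 1) * ((k : ℝ) ^ 2 + 1)) with hw
  have hw0 : ∀ k, 0 ≤ w k := fun k => mul_nonneg (hF k) (by positivity)
  have hwsum : Summable w := summable_mul_of_rapidlyDecreasing hdec hF
  have hFsum : Summable F := by
    by_contra h
    simp [tsum_eq_zero_of_not_summable h] at hsum
  set τ : ℕ → ℝ := fun m => ∑' k, w (k + (m + 1)) with hτ
  have hτ0 : ∀ m, 0 ≤ τ m := fun m => tsum_nonneg fun k => hw0 _
  have hτlim : Filter.Tendsto τ Filter.atTop (nhds 0) :=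
    (tendsto_sum_nat_add w).comp (Filter.tendsto_add_atTop_nat 1)
  have hmass : Filter.Tendsto (fun m => ∑ k ∈ Finset.range (m + 1), F k) Filter.atTop (nhds 1) := by
    rw [← hsum]
    exact hFsum.hasSum.tendsto_sum_nat.comp (Filter.tendsto_add_atTop_nat 1)
  have hlim : Filter.Tendsto (fun m => F n / (∑ k ∈ Finset.range (m + 1), F k + 2 * τ m))
      Filter.atTop (nhds (F n)) := by
    have h := (tendsto_const_nhds (x := F n)).div (hmass.add (hτlim.const_mul 2)) (by norm_num)
    rwa [mul_zero, add_zero, div_one] at h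
  obtain ⟨m, hma, hm1, hmn⟩ := ((hlim.eventually_const_lt ha).and
    ((hmass.eventually_const_lt zero_lt_one).and (Filter.eventually_ge_atTop n))).exists
  have hbound : ∀ x : ℝ, 0 ≤ x → ∀ k, |F k * laguerreFun k x| ≤ F k * (2 * k + 1) :=
    fun x hx k => by
      rw [abs_mul, abs_of_nonneg (hF k)]
      exact mul_le_mul_of_nonneg_left (abs_laguerreFun_le k hx) (hF k)
  have hsummable : ∀ x : ℝ, 0 ≤ x → Summable fun k => F k * laguerreFun k x := fun x hx => by
    refine Summable.of_norm_bounded hwsum fun k => (hbound x hx k).trans ?_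
    refine mul_le_mul_of_nonneg_left ?_ (hF k)
    exact le_mul_of_one_le_right (by positivity) (by nlinarith [sq_nonneg (k : ℝ)])
  have hneg : ∀ x : ℝ, 0 ≤ x →
      -(τ m / ((m : ℝ) ^ 2 + 1)) ≤ ∑ k ∈ Finset.range (m + 1), F k * laguerreFun k x := by
    intro x hx
    have hsplit := (hsummable x hx).sum_add_tsum_nat_add (m + 1)
    have htail : ∑' k, F (k + (m + 1)) * laguerreFun (k + (m + 1)) x
        ≤ τ m / ((m : ℝ) ^ 2 + 1) := by
      rw [hτ, ← tsum_div_const]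
      refine Summable.tsum_le_tsum (fun k => ?_)
        ((summable_nat_add_iff (m + 1)).2 (hsummable x hx))
        (((summable_nat_add_iff (m + 1)).2 hwsum).div_const _)
      refine (le_abs_self _).trans ((hbound x hx _).trans ?_)
      rw [le_div_iff₀ (by positivity), hw, mul_assoc]
      refine mul_le_mul_of_nonneg_left (mul_le_mul_of_nonneg_left ?_ (by positivity)) (hF _)
      have : (m : ℝ) ≤ ((k + (m + 1) : ℕ) : ℝ) := by exact_mod_cast (by omega)
      gcongr
    have := hpos x hx
    linarith
  obtain ⟨G, hG, hGn⟩ := exists_isFiniteFeasible_of_neg_le hF (hτ0 m) hneg hm1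
  exact ⟨m ^ 2, G, hG, hma.trans_le (hGn n hmn)⟩

/-- A finitely supported feasible point is feasible for the linear program. -/
lemma IsFiniteFeasible.mem_lp {m : ℕ} {F : ℕ → ℝ} (hF : IsFiniteFeasible m F) :
    (∀ p : ℕ, ∃ C : ℝ, ∀ k : ℕ, (k : ℝ) ^ p * |F k| ≤ C) ∧
    (∀ k, 0 ≤ F k) ∧ (∑' k, F k) = 1 ∧
    (∀ x : ℝ, 0 ≤ x → 0 ≤ ∑' k, F k * laguerreFun k x) := by
  have hz : ∀ k ∉ Finset.range (m + 1), F k = 0 := fun k hk => hF.support k (by simpa using hk)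
  refine ⟨fun p => ⟨(m : ℝ) ^ p, fun k => ?_⟩, hF.nonneg, ?_, fun x hx => ?_⟩
  · rcases le_or_gt k m with h | h
    · calc (k : ℝ) ^ p * |F k| ≤ (m : ℝ) ^ p * 1 := by
            gcongr
            rw [abs_of_nonneg (hF.nonneg k)]
            exact hF.le_one k
        _ = (m : ℝ) ^ p := mul_one _
    · rw [hF.support k h, abs_zero, mul_zero]
      positivity
  · rw [tsum_eq_sum hz, hF.sum_eq_one]
  · rw [tsum_eq_sum fun k hk => by rw [hz k hk, zero_mul]]
    exact hF.series_nonneg x hx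

/-- for `n ≥ 1`, the sequence of optimal values of the semidefinite
restrictions is nondecreasing (for `m ≥ n`) and converges to the optimal value of the
linear program `(LP^{𝒮}_n)` over rapidly decreasing sequences. -/
theorem restriction_hierarchy_converges (n : ℕ) (hn : 1 ≤ n) :
    (∀ m m' : ℕ, n ≤ m → m ≤ m' → sdpRestrVal n m ≤ sdpRestrVal n m') ∧
    Filter.Tendsto (fun m => sdpRestrVal n m) Filter.atTop (nhds (lpSchwartzVal n)) := by
  have hne : ∀ m, {v : ℝ | ∃ F, IsFiniteFeasible m F ∧ v = F n}.Nonempty := fun m =>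
    ⟨_, _, isFiniteFeasible_single_zero m, rfl⟩
  have hbdd : ∀ m, BddAbove {v : ℝ | ∃ F, IsFiniteFeasible m F ∧ v = F n} := fun m =>
    ⟨1, by rintro v ⟨F, hF, rfl⟩; exact hF.le_one n⟩
  have hmono : ∀ m m' : ℕ, n ≤ m → m ≤ m' → sdpRestrVal n m ≤ sdpRestrVal n m' := by
    intro m m' hnm hmm'
    rw [sdpRestrVal_eq hnm, sdpRestrVal_eq (hnm.trans hmm')]
    refine csSup_le_csSup (hbdd m') (hne m) ?_
    rintro v ⟨F, hF, rfl⟩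
    exact ⟨F, hF.mono hmm', rfl⟩
  refine ⟨hmono, tendsto_order.2 ⟨fun a ha => ?_, fun a ha => ?_⟩⟩
  · rw [lpSchwartzVal] at ha
    obtain ⟨F₀, hF₀⟩ : ∃ F, IsFiniteFeasible 0 F := ⟨_, isFiniteFeasible_single_zero 0⟩
    obtain ⟨h₁, h₂, h₃, h₄⟩ := hF₀.mem_lp
    obtain ⟨v, ⟨F, hdec, hF, hsum, hpos, rfl⟩, hav⟩ :=
      exists_lt_of_lt_csSup (by exact ⟨F₀ n, F₀, h₁, h₂, h₃, h₄, rfl⟩) ha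
    obtain ⟨M, G, hG, haG⟩ := exists_isFiniteFeasible_gt hdec hF hsum hpos n hav
    filter_upwards [Filter.eventually_ge_atTop (max n M)] with m hm
    rw [sdpRestrVal_eq ((le_max_left n M).trans hm)]
    exact haG.trans_le (le_csSup (hbdd m) ⟨G, hG.mono ((le_max_right n M).trans hm), rfl⟩)
  · filter_upwards [Filter.eventually_ge_atTop n] with m hm
    refine lt_of_le_of_lt ?_ ha
    rw [sdpRestrVal_eq hm, lpSchwartzVal]
    refine csSup_le_csSup ⟨1, ?_⟩ (hne m) ?_
    · rintro v ⟨F, -, hF, hsum, -, rfl⟩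
      have hFsum : Summable F := by
        by_contra h
        simp [tsum_eq_zero_of_not_summable h] at hsum
      rw [← hsum]
      exact hFsum.le_tsum n fun k _ => hF k
    · rintro v ⟨F, hF, rfl⟩
      obtain ⟨h₁, h₂, h₃, h₄⟩ := hF.mem_lp
      exact ⟨F, h₁, h₂, h₃, h₄, rfl⟩
end
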